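/- Let C be a convex body in the plane (a compact convex subset of ℝ² with nonempty interior), let m ≥ 3, and let Z₁, …, Zₘ be pairwise-disjoint convex bodies contained in C. Then there exist a natural number b with b ≤ 2m − 5 and convex bodies Z'₁, …, Z'_{m+b} such that the Z'ᵢ are pairwise interior-disjoint (interior Z'ᵢ ∩ interior Z'ⱼ = ∅ for i ≠ j), their union equals C, and Zᵢ ⊆ Z'ᵢ for every i ≤ m. -/

import Mathlib

/-- A convex body in the plane: a compact convex subset of ℝ² with nonempty interior. -/
def IsConvexBody (S : Set (ℝ × ℝ)) : Prop :=
  IsCompact S ∧ Convex ℝ S ∧ (interior S).Nonempty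

namespace Cake

open Set Filter Topology

/-- An affine functional on the plane. -/
@[ext] structure Fn where
  a : ℝ
  b : ℝ
  c : ℝ

def ev (φ : Fn) (p : ℝ × ℝ) : ℝ := φ.a * p.1 + φ.b * p.2 + φ.c
def ln (φ : Fn) (p : ℝ × ℝ) : ℝ := φ.a * p.1 + φ.b * p.2
def cr (p q : ℝ × ℝ) : ℝ := p.1 * q.2 - p.2 * q.1
def dir (σ : ℝ) (φ : Fn) : ℝ × ℝ := (-σ * φ.b, σ * φ.a)

lemma ev_add (φ : Fn) (p w : ℝ × ℝ) : ev φ (p + w) = ev φ p + ln φ w := by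
  simp [ev, ln]; ring
lemma ev_sub (φ : Fn) (p w : ℝ × ℝ) : ev φ (p - w) = ev φ p - ln φ w := by
  simp [ev, ln]; ring
lemma ln_add (φ : Fn) (p w : ℝ × ℝ) : ln φ (p + w) = ln φ p + ln φ w := by
  simp [ln]; ring
lemma ln_sub (φ : Fn) (p w : ℝ × ℝ) : ln φ (p - w) = ln φ p - ln φ w := by
  simp [ln]; ring
lemma ln_smul (φ : Fn) (t : ℝ) (w : ℝ × ℝ) : ln φ (t • w) = t * ln φ w := by
  simp [ln]; ring
lemma ln_neg (φ : Fn) (w : ℝ × ℝ) : ln φ (-w) = - ln φ w := by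
  simp [ln]; ring
lemma ln_sub_pts (φ : Fn) (p q : ℝ × ℝ) : ln φ (p - q) = ev φ p - ev φ q := by
  simp [ev, ln]; ring
lemma ln_dir_self (σ : ℝ) (φ : Fn) : ln φ (dir σ φ) = 0 := by
  simp [ln, dir]; ring
lemma ln_dir_anti (σ : ℝ) (φ ψ : Fn) : ln φ (dir σ ψ) = - ln ψ (dir σ φ) := by
  simp [ln, dir]; ring
lemma cr_dir (σ : ℝ) (φ : Fn) (w : ℝ × ℝ) : cr w (dir σ φ) = σ * ln φ w := by
  simp [ln, dir, cr]; ring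
lemma cr_add (w p q : ℝ × ℝ) : cr w (p + q) = cr w p + cr w q := by simp [cr]; ring
lemma cr_sub (w p q : ℝ × ℝ) : cr w (p - q) = cr w p - cr w q := by simp [cr]; ring
lemma cr_smul (w q : ℝ × ℝ) (t : ℝ) : cr w (t • q) = t * cr w q := by simp [cr]; ring
lemma cr_neg (w q : ℝ × ℝ) : cr w (-q) = - cr w q := by simp [cr]; ring
lemma cr_self (w : ℝ × ℝ) : cr w w = 0 := by simp [cr]; ring

lemma ev_continuous (φ : Fn) : Continuous (ev φ) := by unfold ev; fun_prop

/-- A maximal family of pairwise disjoint open convex sets, written as polyhedra. -/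
structure Cfg (ι : Type) [Fintype ι] where
  cons : ι → Finset Fn
  unit : ∀ i, ∀ φ ∈ cons i, φ.a ^ 2 + φ.b ^ 2 = 1
  ne : ∀ i, ∃ p, ∀ φ ∈ cons i, ev φ p < 0
  disj : ∀ i j, i ≠ j → ∀ p, (∀ φ ∈ cons i, ev φ p < 0) → (∀ φ ∈ cons j, ev φ p < 0) → False
  maxl : ∀ i, ∀ V : Set (ℝ × ℝ), IsOpen V → Convex ℝ V →
    (∀ p, (∀ φ ∈ cons i, ev φ p < 0) → p ∈ V) →
    (∀ j, j ≠ i → ∀ p ∈ V, (∀ φ ∈ cons j, ev φ p < 0) → False) →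
    ∀ p ∈ V, ∀ φ ∈ cons i, ev φ p < 0

variable {ι : Type} [Fintype ι] (c : Cfg ι)

def Cfg.U (i : ι) : Set (ℝ × ℝ) := {p | ∀ φ ∈ c.cons i, ev φ p < 0}
def Cfg.CU (i : ι) : Set (ℝ × ℝ) := {p | ∀ φ ∈ c.cons i, ev φ p ≤ 0}
def Cfg.K : Set (ℝ × ℝ) := {p | ∀ i, p ∉ c.CU i}

lemma U_sub_CU (i : ι) : c.U i ⊆ c.CU i := fun _ hp φ hφ => (hp φ hφ).le

lemma convex_ev_le (φ : Fn) : Convex ℝ {p | ev φ p ≤ 0} := by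
  intro x hx y hy a b ha hb hab
  simp only [mem_ofPred_eq, ev, Prod.fst_add, Prod.snd_add, Prod.smul_fst, Prod.smul_snd, smul_eq_mul] at *
  have : b = 1 - a := by linarith
  subst this
  nlinarith

lemma convex_ev_lt (φ : Fn) : Convex ℝ {p | ev φ p < 0} := by
  intro x hx y hy a b ha hb hab
  simp only [mem_ofPred_eq, ev, Prod.fst_add, Prod.snd_add, Prod.smul_fst, Prod.smul_snd, smul_eq_mul] at *
  have : b = 1 - a := by linarith
  subst this
  rcases eq_or_lt_of_le ha with h | h
  · subst h; simpa using hy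
  · nlinarith

lemma convex_ev_gt (φ : Fn) : Convex ℝ {p | 0 < ev φ p} := by
  have := convex_ev_lt ⟨-φ.a, -φ.b, -φ.c⟩
  convert this using 2
  funext p
  simp only [ev, eq_iff_iff]
  constructor <;> intro h <;> linarith

lemma CU_eq (i : ι) : c.CU i = ⋂ φ ∈ c.cons i, {p | ev φ p ≤ 0} := by
  ext p; simp [Cfg.CU]
lemma U_eq (i : ι) : c.U i = ⋂ φ ∈ c.cons i, {p | ev φ p < 0} := by
  ext p; simp [Cfg.U]

lemma convex_CU (i : ι) : Convex ℝ (c.CU i) := by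
  rw [CU_eq]; exact convex_iInter₂ fun φ _ => convex_ev_le φ
lemma convex_U (i : ι) : Convex ℝ (c.U i) := by
  rw [U_eq]; exact convex_iInter₂ fun φ _ => convex_ev_lt φ
lemma closed_CU (i : ι) : IsClosed (c.CU i) := by
  rw [CU_eq]
  exact isClosed_biInter fun φ _ => isClosed_le (ev_continuous φ) continuous_const
lemma open_U (i : ι) : IsOpen (c.U i) := by
  rw [U_eq]
  exact isOpen_biInter_finset fun φ _ => isOpen_lt (ev_continuous φ) continuous_const
lemma open_K : IsOpen c.K := by
  have : c.K = ⋂ i, (c.CU i)ᶜ := by ext p; simp [Cfg.K]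
  rw [this]
  exact isOpen_iInter_of_finite fun i => (closed_CU c i).isOpen_compl

/-- moving from a closed point into the open set -/
lemma mem_U_of_CU {i : ι} {v z : ℝ × ℝ} (hv : v ∈ c.CU i) (hz : z ∈ c.U i) {t : ℝ} (h0 : 0 < t)
    (h1 : t ≤ 1) : v + t • (z - v) ∈ c.U i := by
  intro φ hφ
  rw [ev_add, ln_smul, ln_sub_pts]
  have := hv φ hφ
  have := hz φ hφ
  nlinarith

lemma small_CU {k : ι} {v w : ℝ × ℝ} (hv : v ∈ c.CU k)
    (hw : ∀ φ ∈ c.cons k, ev φ v = 0 → ln φ w ≤ 0) :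
    ∀ᶠ ε in 𝓝[>] (0 : ℝ), v + ε • w ∈ c.CU k := by
  have : ∀ᶠ ε in 𝓝[>] (0 : ℝ), ∀ φ ∈ c.cons k, ev φ (v + ε • w) ≤ 0 := by
    rw [Filter.eventually_all_finset]
    intro φ hφ
    rcases eq_or_lt_of_le (hv φ hφ) with h | h
    · filter_upwards [self_mem_nhdsWithin] with ε hε
      have hε : 0 < ε := hε
      rw [ev_add, ln_smul, h]
      have := hw φ hφ h
      nlinarith
    · have hc : Tendsto (fun ε : ℝ => ev φ (v + ε • w)) (𝓝[>] 0) (𝓝 (ev φ v)) := by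
        have : Continuous fun ε : ℝ => ev φ (v + ε • w) :=
          (ev_continuous φ).comp (by fun_prop)
        have := this.tendsto 0
        simp only [zero_smul, add_zero] at this
        exact this.mono_left nhdsWithin_le_nhds
      exact (hc.eventually (gt_mem_nhds h)).mono fun _ h => le_of_lt h
  exact this

lemma small_U {k : ι} {v w : ℝ × ℝ} (hv : v ∈ c.CU k)
    (hw : ∀ φ ∈ c.cons k, ev φ v = 0 → ln φ w < 0) :
    ∀ᶠ ε in 𝓝[>] (0 : ℝ), v + ε • w ∈ c.U k := by
  have : ∀ᶠ ε in 𝓝[>] (0 : ℝ), ∀ φ ∈ c.cons k, ev φ (v + ε • w) < 0 := by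
    rw [Filter.eventually_all_finset]
    intro φ hφ
    rcases eq_or_lt_of_le (hv φ hφ) with h | h
    · filter_upwards [self_mem_nhdsWithin] with ε hε
      have hε : 0 < ε := hε
      rw [ev_add, ln_smul, h]
      have := hw φ hφ h
      nlinarith
    · have hc : Tendsto (fun ε : ℝ => ev φ (v + ε • w)) (𝓝[>] 0) (𝓝 (ev φ v)) := by
        have : Continuous fun ε : ℝ => ev φ (v + ε • w) :=
          (ev_continuous φ).comp (by fun_prop)
        have := this.tendsto 0
        simp only [zero_smul, add_zero] at this
        exact this.mono_left nhdsWithin_le_nhds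
      exact (hc.eventually (gt_mem_nhds h))
  exact this

/-- Local lemma: rotating from the free direction `w0` to the first set. -/
lemma local_first {σ : ℝ} (hσ : σ * σ = 1) (v w0 : ℝ × ℝ) (A : Set ι) (hA0 : A.Nonempty)
    (hA : ∀ k ∈ A, v ∈ c.CU k ∧ (∀ z ∈ c.U k, 0 < σ * cr w0 (z - v)) ∧
      ∀ ε : ℝ, 0 < ε → v + ε • w0 ∉ c.CU k) :
    ∃ k ∈ A, ∃ φ ∈ c.cons k, ev φ v = 0 ∧ 0 < ln φ w0 ∧
      (∃ b0 : ℝ, 0 < b0 ∧ v + b0 • dir σ φ ∈ c.CU k) ∧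
      (∀ k' ∈ A, ∀ a b : ℝ, 0 < a → 0 < b → v + a • w0 + b • dir σ φ ∉ c.CU k') ∧
      (∀ k' ∈ A, k' ≠ k → ∀ b : ℝ, 0 < b → v + b • dir σ φ ∉ c.CU k') := by
  classical
  have hw0 : 0 < w0.1 ^ 2 + w0.2 ^ 2 := by
    obtain ⟨k, hk⟩ := hA0
    obtain ⟨z, hz⟩ := c.ne k
    have := (hA k hk).2.1 z hz
    by_contra h
    have h1 : w0.1 = 0 := by nlinarith [sq_nonneg w0.1, sq_nonneg w0.2]
    have h2 : w0.2 = 0 := by nlinarith [sq_nonneg w0.1, sq_nonneg w0.2]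
    simp [cr, h1, h2] at this
  set r := w0.1 ^ 2 + w0.2 ^ 2 with hr
  set n' : ℝ × ℝ := (-(σ * w0.2 / r), σ * w0.1 / r) with hn'
  have hdec : ∀ x : ℝ × ℝ, ∃ β : ℝ, ∀ χ : Fn,
      ln χ x = (σ * cr w0 x) * ln χ n' - β * ln χ w0 := by
    intro x
    refine ⟨-((w0.1 * x.1 + w0.2 * x.2) / r), fun χ => ?_⟩
    simp only [ln, cr, hn']
    field_simp
    rw [show (σ : ℝ) ^ 2 = 1 by rw [sq, hσ]]
    rw [hr]; ring
  have hcrn : σ * cr w0 n' = 1 := by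
    simp only [cr, hn']
    field_simp
    rw [show (σ : ℝ) ^ 2 = 1 by rw [sq, hσ], hr]; ring
  -- active lower constraints
  let act : ι → Finset Fn := fun k => (c.cons k).filter fun φ => ev φ v = 0 ∧ 0 < ln φ w0
  let τ : Fn → ℝ := fun φ => ln φ n' / ln φ w0
  have hact : ∀ k ∈ A, (act k).Nonempty := by
    intro k hk
    by_contra hne
    obtain ⟨h1, h2, h3⟩ := hA k hk
    have h4 : ∀ φ ∈ c.cons k, ev φ v = 0 → ln φ w0 ≤ 0 := by
      intro φ hφ h0
      by_contra hlt
      exact hne ⟨φ, by simp only [act, Finset.mem_filter]; exact ⟨hφ, h0, not_le.mp hlt⟩⟩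
    obtain ⟨ε, hε, hpos⟩ := ((small_CU c h1 h4).and self_mem_nhdsWithin).exists
    exact h3 ε hpos hε
  have hmax : ∀ k : ι, ∃ φ : Fn, k ∈ A → φ ∈ act k ∧ ∀ χ ∈ act k, τ χ ≤ τ φ := by
    intro k
    by_cases hk : k ∈ A
    · obtain ⟨φ, h1, h2⟩ := Finset.exists_max_image (act k) τ (hact k hk)
      exact ⟨φ, fun _ => ⟨h1, h2⟩⟩
    · exact ⟨⟨0, 0, 0⟩, fun h => absurd h hk⟩
  choose Φ hΦ using hmax
  obtain ⟨k, hkA, hkmin⟩ := Set.exists_min_image A (fun k => τ (Φ k)) A.toFinite hA0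
  have hmem : ∀ k ∈ A, Φ k ∈ c.cons k ∧ ev (Φ k) v = 0 ∧ 0 < ln (Φ k) w0 := by
    intro k hk
    have := (hΦ k hk).1
    simpa only [act, Finset.mem_filter] using this
  have hτ : ∀ k ∈ A, ln (Φ k) n' = τ (Φ k) * ln (Φ k) w0 := by
    intro k hk
    have := (hmem k hk).2.2
    simp only [τ]; field_simp
  obtain ⟨hφ, hφ0, hφw⟩ := hmem k hkA
  -- interior data
  have hintr : ∀ k ∈ A, ∃ τz : ℝ, τ (Φ k) < τz ∧
      ∀ t : ℝ, τ (Φ k) < t → t ≤ τz → ∀ χ ∈ c.cons k, ev χ v = 0 → ln χ n' - t * ln χ w0 < 0 := by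
    intro k hk
    obtain ⟨z, hz⟩ := c.ne k
    obtain ⟨β, hβ⟩ := hdec (z - v)
    have hα := (hA k hk).2.1 z hz
    set α := σ * cr w0 (z - v)
    have hz' : ∀ χ ∈ c.cons k, ev χ v = 0 → ln χ n' - (β / α) * ln χ w0 < 0 := by
      intro χ hχ h0
      have h1 := hβ χ
      rw [ln_sub_pts, h0] at h1
      have h2 := hz χ hχ
      have h3 : α * (ln χ n' - (β / α) * ln χ w0) < 0 := by
        have : α * (ln χ n' - (β / α) * ln χ w0) = α * ln χ n' - β * ln χ w0 := by
          field_simp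
        rw [this]; linarith
      by_contra hcon
      push Not at hcon
      nlinarith
    obtain ⟨m1, m2, m3⟩ := hmem k hk
    refine ⟨β / α, ?_, ?_⟩
    · have := hz' _ m1 m2
      rw [hτ k hk] at this
      nlinarith
    · intro t ht1 ht2 χ hχ h0
      by_cases hpos : 0 < ln χ w0
      · have hχa : χ ∈ act k := by simp only [act, Finset.mem_filter]; exact ⟨hχ, h0, hpos⟩
        have h5 := (hΦ k hk).2 χ hχa
        have h6 : ln χ n' = τ χ * ln χ w0 := by simp only [τ]; field_simp
        rw [h6]; nlinarith
      · have := hz' χ hχ h0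
        push Not at hpos
        nlinarith
  have hdir : ∀ χ : Fn, ln χ (dir σ (Φ k)) =
      ln (Φ k) w0 * (ln χ n' - τ (Φ k) * ln χ w0) := by
    intro χ
    obtain ⟨β, hβ⟩ := hdec (dir σ (Φ k))
    have h1 : σ * cr w0 (dir σ (Φ k)) = ln (Φ k) w0 := by
      rw [cr_dir, ← mul_assoc, hσ, one_mul]
    rw [h1] at hβ
    have h2 := hβ (Φ k)
    rw [ln_dir_self, hτ k hkA] at h2
    have h3 : β = ln (Φ k) w0 * τ (Φ k) := by
      have : ln (Φ k) w0 * (ln (Φ k) w0 * τ (Φ k) - β) = 0 := by linarith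
      rcases mul_eq_zero.mp this with h | h <;> linarith
    rw [hβ χ, h3]; ring
  refine ⟨k, hkA, Φ k, hφ, hφ0, hφw, ?_, ?_, ?_⟩
  · have h4 : ∀ χ ∈ c.cons k, ev χ v = 0 → ln χ (dir σ (Φ k)) ≤ 0 := by
      intro χ hχ h0
      rw [hdir]
      obtain ⟨τz, h1, h2⟩ := hintr k hkA
      have : ln χ n' - τ (Φ k) * ln χ w0 ≤ 0 := by
        by_cases hpos : 0 < ln χ w0
        · have hχa : χ ∈ act k := by simp only [act, Finset.mem_filter]; exact ⟨hχ, h0, hpos⟩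
          have h5 := (hΦ k hkA).2 χ hχa
          have h6 : ln χ n' = τ χ * ln χ w0 := by simp only [τ]; field_simp
          rw [h6]; nlinarith
        · have := h2 τz h1 le_rfl χ hχ h0
          push Not at hpos
          nlinarith
      nlinarith
    obtain ⟨ε, hε, hpos⟩ := ((small_CU c (hA k hkA).1 h4).and self_mem_nhdsWithin).exists
    exact ⟨ε, hpos, hε⟩
  · intro k' hk' a b ha hb hmem'
    obtain ⟨m1, m2, m3⟩ := hmem k' hk'
    have h1 := hmem' _ m1
    rw [ev_add, ev_add, ln_smul, ln_smul, m2, hdir, hτ k' hk'] at h1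
    have h2 : τ (Φ k) ≤ τ (Φ k') := hkmin k' hk'
    have h3 : 0 ≤ b * (ln (Φ k) w0 * (τ (Φ k') * ln (Φ k') w0 - τ (Φ k) * ln (Φ k') w0)) := by
      have : 0 ≤ (τ (Φ k') - τ (Φ k)) * ln (Φ k') w0 := mul_nonneg (by linarith) m3.le
      have := mul_nonneg hb.le (mul_nonneg hφw.le this)
      nlinarith
    nlinarith [mul_pos ha m3]
  · intro k' hk' hkk b hb hmem'
    obtain ⟨m1, m2, m3⟩ := hmem k' hk'
    have h1 := hmem' _ m1
    rw [ev_add, ln_smul, m2, hdir, hτ k' hk'] at h1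
    have h2 : τ (Φ k) ≤ τ (Φ k') := hkmin k' hk'
    have h3 : τ (Φ k') = τ (Φ k) := by
      by_contra hne
      have hlt : 0 < τ (Φ k') - τ (Φ k) := by
        rcases lt_or_eq_of_le h2 with h | h
        · linarith
        · exact absurd h.symm hne
      have := mul_pos hb (mul_pos hφw (mul_pos hlt m3))
      nlinarith
    obtain ⟨z1, h4, h5⟩ := hintr k hkA
    obtain ⟨z2, h6, h7⟩ := hintr k' hk'
    rw [h3] at h6 h7
    set t := min z1 z2
    have ht : τ (Φ k) < t := lt_min h4 h6
    have e1 := small_U c (w := n' - t • w0) (hA k hkA).1 (fun χ hχ h0 => by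
      rw [ln_sub, ln_smul]; exact h5 t ht (min_le_left _ _) χ hχ h0)
    have e2 := small_U c (w := n' - t • w0) (hA k' hk').1 (fun χ hχ h0 => by
      rw [ln_sub, ln_smul]; exact h7 t ht (min_le_right _ _) χ hχ h0)
    obtain ⟨ε, hε1, hε2⟩ := (e1.and e2).exists
    exact c.disj k k' hkk.symm _ hε1 hε2

end Cake

namespace Cake

open Set Filter Topology
variable {ι : Type} [Fintype ι] (c : Cfg ι)

lemma dir_sq {σ : ℝ} (hσ : σ * σ = 1) {φ : Fn} (hφ : φ.a ^ 2 + φ.b ^ 2 = 1) :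
    (dir σ φ).1 ^ 2 + (dir σ φ).2 ^ 2 = 1 := by
  simp only [dir]; linear_combination (φ.a^2+φ.b^2) * hσ + hφ

/-- coordinate along an edge -/
def tc (σ : ℝ) (φ : Fn) (p : ℝ × ℝ) : ℝ := -σ * φ.b * p.1 + σ * φ.a * p.2

lemma tc_add (σ : ℝ) (φ : Fn) (p w : ℝ × ℝ) : tc σ φ (p + w) = tc σ φ p + tc σ φ w := by
  simp [tc]; ring
lemma tc_sub (σ : ℝ) (φ : Fn) (p w : ℝ × ℝ) : tc σ φ (p - w) = tc σ φ p - tc σ φ w := by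
  simp [tc]; ring
lemma tc_smul (σ : ℝ) (φ : Fn) (t : ℝ) (w : ℝ × ℝ) : tc σ φ (t • w) = t * tc σ φ w := by
  simp [tc]; ring
lemma tc_dir {σ : ℝ} (hσ : σ * σ = 1) {φ : Fn} (hφ : φ.a ^ 2 + φ.b ^ 2 = 1) :
    tc σ φ (dir σ φ) = 1 := by
  simp only [tc, dir]; linear_combination (φ.a^2+φ.b^2) * hσ + hφ

lemma on_line {σ : ℝ} (hσ : σ * σ = 1) {φ : Fn} (hφ : φ.a ^ 2 + φ.b ^ 2 = 1) {p q : ℝ × ℝ}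
    (hp : ev φ p = 0) (hq : ev φ q = 0) : p = q + (tc σ φ p - tc σ φ q) • dir σ φ := by
  have h : φ.a * (p.1 - q.1) + φ.b * (p.2 - q.2) = 0 := by
    simp only [ev] at hp hq; linarith
  ext
  · simp only [tc, dir, Prod.fst_add, Prod.smul_fst, smul_eq_mul]
    linear_combination (-φ.b^2*(p.1-q.1) + φ.a*φ.b*(p.2-q.2)) * hσ - (p.1 - q.1) * hφ + φ.a * h
  · simp only [tc, dir, Prod.snd_add, Prod.smul_snd, smul_eq_mul]
    linear_combination (φ.a*φ.b*(p.1-q.1) - φ.a^2*(p.2-q.2)) * hσ - (p.2 - q.2) * hφ + φ.b * h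

/-- relative interior point of the edge `φ` of the set `i` -/
def Cfg.Rel (i : ι) (φ : Fn) (y : ℝ × ℝ) : Prop :=
  φ ∈ c.cons i ∧ ev φ y = 0 ∧ ∃ ε : ℝ, 0 < ε ∧ y + ε • dir 1 φ ∈ c.CU i ∧ y - ε • dir 1 φ ∈ c.CU i

def Cfg.Tch (i : ι) (p : ℝ × ℝ) : Prop := ∃ k, k ≠ i ∧ p ∈ c.CU k

variable {c}

lemma sig_cases {σ : ℝ} (hσ : σ * σ = 1) : σ = 1 ∨ σ = -1 := by
  have : (σ - 1) * (σ + 1) = 0 := by linarith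
  rcases mul_eq_zero.mp this with h | h
  · left; linarith
  · right; linarith

lemma dir_neg (φ : Fn) : dir (-1) φ = - dir 1 φ := by
  ext <;> simp [dir]

lemma Cfg.Rel.mem {i : ι} {φ : Fn} {y : ℝ × ℝ} (h : c.Rel i φ y) : y ∈ c.CU i := by
  obtain ⟨_, _, ε, hε, h1, h2⟩ := h
  intro χ hχ
  have a1 := h1 χ hχ
  have a2 := h2 χ hχ
  rw [ev_add] at a1
  rw [ev_sub] at a2
  linarith

lemma Cfg.Rel.dirs {i : ι} {φ : Fn} {y : ℝ × ℝ} (h : c.Rel i φ y) {σ : ℝ} (hσ : σ * σ = 1) :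
    ∃ ε : ℝ, 0 < ε ∧ y + ε • dir σ φ ∈ c.CU i ∧ y - ε • dir σ φ ∈ c.CU i := by
  obtain ⟨_, _, ε, hε, h1, h2⟩ := h
  refine ⟨ε, hε, ?_⟩
  rcases sig_cases hσ with rfl | rfl
  · exact ⟨h1, h2⟩
  · rw [dir_neg, smul_neg, sub_neg_eq_add]
    exact ⟨by rwa [← sub_eq_add_neg], h1⟩

lemma CU_seg {i : ι} {p q : ℝ × ℝ} (hp : p ∈ c.CU i) (hq : q ∈ c.CU i) {s : ℝ} (h0 : 0 ≤ s)
    (h1 : s ≤ 1) : p + s • (q - p) ∈ c.CU i := by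
  intro φ hφ
  rw [ev_add, ln_smul, ln_sub_pts]
  have := hp φ hφ
  have := hq φ hφ
  nlinarith

lemma CU_ray {i : ι} {p w : ℝ × ℝ} (hp : p ∈ c.CU i) {e s : ℝ} (hq : p + e • w ∈ c.CU i)
    (h0 : 0 ≤ s) (h1 : s ≤ e) : p + s • w ∈ c.CU i := by
  rcases eq_or_lt_of_le (h0.trans h1) with h | h
  · have : s = 0 := by linarith
    subst this; simpa using hp
  · have := CU_seg hp hq (s := s / e) (by positivity) (by rw [div_le_one h]; exact h1)
    rw [add_sub_cancel_left, smul_smul, div_mul_cancel₀ _ h.ne'] at this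
    exact this

lemma Cfg.Rel.of_dirs {i : ι} {φ : Fn} {y : ℝ × ℝ} (hφ : φ ∈ c.cons i) (h0 : ev φ y = 0) {σ : ℝ}
    (hσ : σ * σ = 1) {e1 e2 : ℝ} (he1 : 0 < e1) (he2 : 0 < e2)
    (h1 : y + e1 • dir σ φ ∈ c.CU i) (h2 : y - e2 • dir σ φ ∈ c.CU i) : c.Rel i φ y := by
  have hy : y ∈ c.CU i := by
    have := CU_ray (w := dir σ φ) h2 (e := e2 + e1) (s := e2) (by convert h1 using 1; module)
      he2.le (by linarith)
    convert this using 1; module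
  have k1 := CU_ray hy h1 (s := min e1 e2) (lt_min he1 he2).le (min_le_left _ _)
  have k2 := CU_ray hy (w := - dir σ φ) (e := e2) (by convert h2 using 1; module)
    (s := min e1 e2) (lt_min he1 he2).le (min_le_right _ _)
  refine ⟨hφ, h0, min e1 e2, lt_min he1 he2, ?_⟩
  rcases sig_cases hσ with rfl | rfl
  · exact ⟨k1, by convert k2 using 1; module⟩
  · rw [dir_neg] at k1 k2
    exact ⟨by convert k2 using 1; module, by convert k1 using 1; module⟩

/-- strictly between a relative interior point and an edge point -/
lemma Cfg.Rel.between {i : ι} {φ : Fn} {y q : ℝ × ℝ} (h : c.Rel i φ y) (hq : q ∈ c.CU i)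
    {s : ℝ} (h0 : 0 ≤ s) (h1 : s < 1) (hq0 : ev φ q = 0) : c.Rel i φ (y + s • (q - y)) := by
  obtain ⟨hφ, hy0, ε, hε, e1, e2⟩ := h
  have k1 := CU_seg e1 hq h0 h1.le
  have k2 := CU_seg e2 hq h0 h1.le
  refine ⟨hφ, ?_, (1 - s) * ε, by nlinarith, ?_, ?_⟩
  · rw [ev_add, ln_smul, ln_sub_pts, hy0, hq0]; simp
  · convert k1 using 1; module
  · convert k2 using 1; module

lemma Cfg.Rel.seg {i : ι} {φ : Fn} {y q : ℝ × ℝ} (h : c.Rel i φ y) (hq : c.Rel i φ q)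
    {s : ℝ} (h0 : 0 ≤ s) (h1 : s ≤ 1) : c.Rel i φ (y + s • (q - y)) := by
  rcases eq_or_lt_of_le h1 with rfl | h1
  · simpa using hq
  · exact h.between hq.mem h0 h1 hq.2.1

lemma Cfg.Rel.near {i : ι} {φ : Fn} {y : ℝ × ℝ} (h : c.Rel i φ y) {σ : ℝ} (hσ : σ * σ = 1) :
    ∃ ε : ℝ, 0 < ε ∧ ∀ s, |s| < ε → c.Rel i φ (y + s • dir σ φ) := by
  obtain ⟨ε, hε, h1, h2⟩ := h.dirs hσ
  refine ⟨ε, hε, fun s hs => ?_⟩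
  rw [abs_lt] at hs
  refine Cfg.Rel.of_dirs h.1 ?_ hσ (e1 := ε - s) (e2 := ε + s) (by linarith) (by linarith) ?_ ?_
  · rw [ev_add, ln_smul, ln_dir_self, h.2.1]; simp
  · convert h1 using 1; module
  · convert h2 using 1; module

lemma eq_of_ln_dir {φ χ : Fn} (h1 : φ.a ^ 2 + φ.b ^ 2 = 1) (h2 : χ.a ^ 2 + χ.b ^ 2 = 1)
    (h : ln χ (dir 1 φ) = 0) {y z : ℝ × ℝ} (e1 : ev φ y = 0) (e2 : ev χ y = 0) (f1 : ev φ z < 0)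
    (f2 : ev χ z < 0) : χ = φ := by
  simp only [ln, dir] at h
  have hs : φ.a * χ.a + φ.b * χ.b = 1 ∨ φ.a * χ.a + φ.b * χ.b = -1 := by
    have : (φ.a * χ.a + φ.b * χ.b) ^ 2 = 1 := by
      linear_combination (χ.a^2+χ.b^2) * h1 + h2 - (-1 * φ.b * χ.a + φ.a * χ.b) * h
    exact sq_eq_one_iff.mp this
  have hs : φ.a * χ.a + φ.b * χ.b = 1 := by
    rcases hs with hs | hs
    · exact hs
    · exfalso
      have a1 : χ.a = -φ.a := by linear_combination -χ.a * h1 + φ.a * hs - φ.b * h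
      have a2 : χ.b = -φ.b := by linear_combination -χ.b * h1 + φ.b * hs + φ.a * h
      simp only [ev, a1, a2] at *
      linarith
  have a1 : χ.a = φ.a := by linear_combination -χ.a * h1 + φ.a * hs - φ.b * h
  have a2 : χ.b = φ.b := by linear_combination -χ.b * h1 + φ.b * hs + φ.a * h
  ext
  · exact a1
  · exact a2
  · simp only [ev, a1, a2] at *; linarith

lemma Cfg.Rel.active {i : ι} {φ χ : Fn} {y : ℝ × ℝ} (h : c.Rel i φ y) (hχ : χ ∈ c.cons i)
    (h0 : ev χ y = 0) : χ = φ := by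
  obtain ⟨hφ, hy0, ε, hε, e1, e2⟩ := h
  obtain ⟨z, hz⟩ := c.ne i
  have a1 := e1 χ hχ
  have a2 := e2 χ hχ
  rw [ev_add, h0, ln_smul] at a1
  rw [ev_sub, h0, ln_smul] at a2
  have : ln χ (dir 1 φ) = 0 := by
    apply le_antisymm
    · by_contra h; push Not at h; nlinarith [mul_pos hε h]
    · by_contra h; push Not at h; nlinarith [mul_pos hε (neg_pos.mpr h)]
  exact eq_of_ln_dir (c.unit i φ hφ) (c.unit i χ hχ) this hy0 h0 (hz φ hφ) (hz χ hχ)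

lemma Cfg.Rel.half {i : ι} {φ : Fn} {y w : ℝ × ℝ} (h : c.Rel i φ y) (hw : ln φ w < 0) :
    ∀ᶠ ε in 𝓝[>] (0 : ℝ), y + ε • w ∈ c.U i :=
  small_U c h.mem fun χ hχ h0 => by rw [h.active hχ h0]; exact hw

lemma Cfg.Rel.half' {i : ι} {φ : Fn} {y w : ℝ × ℝ} (h : c.Rel i φ y) (hw : ln φ w ≤ 0) :
    ∀ᶠ ε in 𝓝[>] (0 : ℝ), y + ε • w ∈ c.CU i :=
  small_CU c h.mem fun χ hχ h0 => by rw [h.active hχ h0]; exact hw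

lemma disjU {i k : ι} (h : i ≠ k) {p : ℝ × ℝ} (h1 : p ∈ c.U i) (h2 : p ∈ c.U k) : False :=
  c.disj i k h p h1 h2

/-- open set moves -/
lemma U_move {k : ι} {z : ℝ × ℝ} (hz : z ∈ c.U k) (w : ℝ × ℝ) :
    ∀ᶠ ε in 𝓝[>] (0 : ℝ), z + ε • w ∈ c.U k :=
  small_U c (U_sub_CU c k hz) fun χ hχ h0 => absurd h0 (hz χ hχ).ne

lemma ev01 : ∀ᶠ ε in 𝓝[>] (0 : ℝ), ε ≤ 1 :=
  (Ioc_mem_nhdsGT (show (0:ℝ) < 1 by norm_num)) |> fun h => mem_of_superset h fun _ hx => hx.2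

lemma Cfg.Rel.side {i k : ι} {φ : Fn} {y z : ℝ × ℝ} (h : c.Rel i φ y) (hik : i ≠ k)
    (hy : y ∈ c.CU k) (hz : z ∈ c.U k) : 0 < ev φ z := by
  have key : ∀ z ∈ c.U k, 0 ≤ ev φ z := by
    intro z hz
    by_contra hcon
    push Not at hcon
    have hw : ln φ (z - y) < 0 := by rw [ln_sub_pts, h.2.1]; linarith
    obtain ⟨ε, ⟨h1, h2⟩, h3⟩ := (((h.half hw).and ev01).and self_mem_nhdsWithin).exists
    exact disjU hik h1 (mem_U_of_CU c hy hz h3 h2)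
  obtain ⟨ε, h1, h3⟩ := ((U_move hz (-φ.a, -φ.b)).and self_mem_nhdsWithin).exists
  have h3 : 0 < ε := h3
  have := key _ h1
  rw [ev_add, ln_smul] at this
  have hu := c.unit i φ h.1
  simp only [ln] at this
  nlinarith

lemma CU_nonneg {k : ι} {φ : Fn} (h : ∀ z ∈ c.U k, 0 ≤ ev φ z) {z : ℝ × ℝ} (hz : z ∈ c.CU k) :
    0 ≤ ev φ z := by
  obtain ⟨p, hp⟩ := c.ne k
  have h1 : ∀ t : ℝ, 0 < t → t ≤ 1 → 0 ≤ ev φ z + t * (ev φ p - ev φ z) := by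
    intro t ht0 ht1
    have := h _ (mem_U_of_CU c hz hp ht0 ht1)
    rwa [ev_add, ln_smul, ln_sub_pts] at this
  by_contra hcon
  push Not at hcon
  have hp0 : 0 ≤ ev φ p := h p hp
  have hd : 0 < ev φ p - ev φ z := by linarith
  have := h1 (-ev φ z / (2 * (ev φ p - ev φ z))) (by apply div_pos <;> linarith)
    (by rw [div_le_one (by linarith)]; linarith)
  have e : -ev φ z / (2 * (ev φ p - ev φ z)) * (ev φ p - ev φ z) = - ev φ z / 2 := by
    field_simp
  rw [e] at this
  linarith

lemma Cfg.Rel.side' {i k : ι} {φ : Fn} {y z : ℝ × ℝ} (h : c.Rel i φ y) (hik : i ≠ k)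
    (hy : y ∈ c.CU k) (hz : z ∈ c.CU k) : 0 ≤ ev φ z :=
  CU_nonneg (fun _ hz => (h.side hik hy hz).le) hz

variable (c)

def Cfg.State (σ : ℝ) (k : ι) (φ : Fn) : Prop :=
  φ ∈ c.cons k ∧ ∃ y, c.Rel k φ y ∧ ∀ z, c.Rel k φ z → tc σ φ z ≤ tc σ φ y → ¬ c.Tch k z

structure LinkL (σ : ℝ) (i : ι) (φ' : Fn) (k : ι) (φ : Fn) (v : ℝ × ℝ) : Prop where
  rel : c.Rel i φ' v
  mem : φ ∈ c.cons k
  ne : i ≠ k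
  vk : v ∈ c.CU k
  v0 : ev φ v = 0
  ext : ∃ b0 : ℝ, 0 < b0 ∧ v + b0 • dir σ φ ∈ c.CU k
  pos : 0 < ln φ' (dir σ φ)
  sector : ∃ e0 : ℝ, 0 < e0 ∧ ∀ a b : ℝ, 0 < a → a < e0 → 0 < b → b < e0 →
    v - a • dir σ φ' + b • dir σ φ ∈ c.K
  free : ∃ e0 : ℝ, 0 < e0 ∧ ∀ b : ℝ, 0 < b → b < e0 → ¬ c.Tch k (v + b • dir σ φ)

structure Link (σ : ℝ) (i : ι) (φ' : Fn) (k : ι) (φ : Fn) (v : ℝ × ℝ) : Prop extends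
    LinkL c σ i φ' k φ v where
  before : ∀ z, c.Rel i φ' z → tc σ φ' z < tc σ φ' v → ¬ c.Tch i z

variable {c}

lemma LinkL.after {σ : ℝ} {i : ι} {φ' : Fn} {k : ι} {φ : Fn} {v : ℝ × ℝ}
    (h : LinkL c σ i φ' k φ v) {s : ℝ} (hs : v + s • dir σ φ ∈ c.CU k) : 0 ≤ s := by
  have := h.rel.side' h.ne h.vk hs
  rw [ev_add, ln_smul, h.rel.2.1] at this
  by_contra hcon
  push Not at hcon
  nlinarith [mul_pos (neg_pos.mpr hcon) h.pos]

lemma LinkL.rel_after {σ : ℝ} (hσ : σ * σ = 1) {i : ι} {φ' : Fn} {k : ι} {φ : Fn} {v : ℝ × ℝ}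
    (h : LinkL c σ i φ' k φ v) {s : ℝ} (hs : c.Rel k φ (v + s • dir σ φ)) : 0 < s := by
  obtain ⟨ε, hε, _, h2⟩ := hs.dirs hσ
  have : v + (s - ε) • dir σ φ ∈ c.CU k := by convert h2 using 1; module
  have := h.after this
  linarith

lemma LinkL.rel_in {σ : ℝ} (hσ : σ * σ = 1) {i : ι} {φ' : Fn} {k : ι} {φ : Fn} {v : ℝ × ℝ}
    (h : LinkL c σ i φ' k φ v) {s b0 : ℝ} (hb : v + b0 • dir σ φ ∈ c.CU k) (h0 : 0 < s)
    (h1 : s < b0) : c.Rel k φ (v + s • dir σ φ) := by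
  refine Cfg.Rel.of_dirs h.mem ?_ hσ (e1 := b0 - s) (e2 := s) (by linarith) h0 ?_ ?_
  · rw [ev_add, ln_smul, ln_dir_self, h.v0]; simp
  · convert hb using 1; module
  · convert h.vk using 1; module

lemma LinkL.state {σ : ℝ} (hσ : σ * σ = 1) {i : ι} {φ' : Fn} {k : ι} {φ : Fn} {v : ℝ × ℝ}
    (h : LinkL c σ i φ' k φ v) : c.State σ k φ := by
  obtain ⟨b0, hb0, hb⟩ := h.ext
  obtain ⟨e0, he0, hf⟩ := h.free
  have hm : 0 < min b0 e0 := lt_min hb0 he0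
  have hu := c.unit k φ h.mem
  refine ⟨h.mem, v + (min b0 e0 / 2) • dir σ φ, h.rel_in hσ hb (by linarith)
    (by have := min_le_left b0 e0; linarith), ?_⟩
  intro z hz ht
  have hz' := on_line hσ hu hz.2.1 h.v0
  rw [hz'] at hz ⊢
  apply hf _ (h.rel_after hσ hz)
  rw [tc_add, tc_smul, tc_dir hσ hu] at ht
  have := min_le_right b0 e0
  linarith

lemma Link.state_pre {σ : ℝ} (hσ : σ * σ = 1) {i : ι} {φ' : Fn} {k : ι} {φ : Fn} {v : ℝ × ℝ}
    (h : Link c σ i φ' k φ v) : c.State σ i φ' := by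
  obtain ⟨ε, hε, hr⟩ := h.rel.near hσ
  refine ⟨h.rel.1, v + (-(ε/2)) • dir σ φ', hr _ (by rw [abs_neg, abs_of_pos] <;> linarith), ?_⟩
  intro z hz ht
  refine h.before z hz ?_
  rw [tc_add, tc_smul, tc_dir hσ (c.unit i φ' h.rel.1)] at ht
  linarith

lemma Link.inj {σ : ℝ} (hσ : σ * σ = 1) {i i2 : ι} {φ' φ2 : Fn} {k : ι} {φ : Fn} {v v2 : ℝ × ℝ}
    (h : LinkL c σ i φ' k φ v) (h2 : LinkL c σ i2 φ2 k φ v2) : i = i2 ∧ φ' = φ2 ∧ v = v2 := by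
  have hu := c.unit k φ h.mem
  have hv : v = v2 := by
    have e1 := on_line hσ hu h2.v0 h.v0
    have e2 := on_line hσ hu h.v0 h2.v0
    have a1 := h.after (e1 ▸ h2.vk)
    have a2 := h2.after (e2 ▸ h.vk)
    have : tc σ φ v - tc σ φ v2 = 0 := by linarith
    rw [this] at e2; simpa using e2
  subst hv
  obtain ⟨z, hz⟩ := c.ne k
  have s1 := h.rel.side h.ne h.vk hz
  have s2 := h2.rel.side h2.ne h2.vk hz
  have w1 : ln φ' (-(z - v)) < 0 := by rw [ln_neg, ln_sub_pts, h.rel.2.1]; linarith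
  have w2 : ln φ2 (-(z - v)) < 0 := by rw [ln_neg, ln_sub_pts, h2.rel.2.1]; linarith
  obtain ⟨ε, h3, h4⟩ := ((h.rel.half w1).and (h2.rel.half w2)).exists
  have hi : i = i2 := by
    by_contra hne
    exact disjU hne h3 h4
  subst hi
  exact ⟨rfl, h2.rel.active h.rel.1 h.rel.2.1, rfl⟩

/-- a closed set not containing `v` is avoided near `v` -/
lemma avoid {k : ι} {v : ℝ × ℝ} (h : v ∉ c.CU k) : ∀ᶠ p in 𝓝 v, p ∉ c.CU k :=
  (closed_CU c k).isOpen_compl.mem_nhds h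

/-- Step lemma. -/
lemma step {σ : ℝ} (hσ : σ * σ = 1) {i : ι} {φ' : Fn} {q y : ℝ × ℝ} (hq : c.Rel i φ' q)
    (ht : c.Tch i q) (hy : c.Rel i φ' y) (hyq : tc σ φ' y < tc σ φ' q)
    (hfree : ∀ z, c.Rel i φ' z → tc σ φ' y ≤ tc σ φ' z → tc σ φ' z < tc σ φ' q → ¬ c.Tch i z) :
    ∃ k φ, LinkL c σ i φ' k φ q := by
  have hu := c.unit i φ' hq.1
  set d := dir σ φ' with hd
  have hA : ∀ k ∈ {k | k ≠ i ∧ q ∈ c.CU k}, q ∈ c.CU k ∧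
      (∀ z ∈ c.U k, 0 < σ * cr (-d) (z - q)) ∧ ∀ ε : ℝ, 0 < ε → q + ε • (-d) ∉ c.CU k := by
    rintro k ⟨hki, hqk⟩
    refine ⟨hqk, ?_, ?_⟩
    · intro z hz
      have := hq.side hki.symm hqk hz
      have e : σ * cr (-d) (z - q) = ln φ' (z - q) := by
        simp only [cr, hd, dir, ln, Prod.fst_neg, Prod.snd_neg]
        linear_combination (φ'.a * (z-q).1 + φ'.b * (z-q).2) * hσ
      rw [e, ln_sub_pts, hq.2.1]; linarith
    · intro ε hε hmem
      set e := min ε (tc σ φ' q - tc σ φ' y) with he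
      have he0 : 0 < e := lt_min hε (by linarith)
      have hm := CU_ray hqk hmem he0.le (min_le_left _ _)
      have hey := on_line hσ hu hy.2.1 hq.2.1
      have hpos : 0 < tc σ φ' q - tc σ φ' y := by linarith
      have hle : e ≤ tc σ φ' q - tc σ φ' y := min_le_right _ _
      have hrel : c.Rel i φ' (q + e • (-d)) := by
        have := hq.seg hy (s := e / (tc σ φ' q - tc σ φ' y)) (by positivity)
          (by rw [div_le_one hpos]; exact hle)
        convert this using 2
        have e2 : y - q = (tc σ φ' q - tc σ φ' y) • (-d) := by
          nth_rewrite 1 [hey]; rw [hd]; module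
        rw [e2, smul_smul, div_mul_cancel₀ _ hpos.ne']
      have ht : tc σ φ' (q + e • (-d)) = tc σ φ' q - e := by
        rw [smul_neg, ← sub_eq_add_neg, tc_sub, tc_smul, hd, tc_dir hσ hu]; ring
      exact hfree _ hrel (by rw [ht]; linarith) (by rw [ht]; linarith) ⟨k, hki, hm⟩
  obtain ⟨k, hkA, φ, hφ, h0, hpos, hext, hsec, hray⟩ := local_first c hσ q (-d)
    {k | k ≠ i ∧ q ∈ c.CU k} ht hA
  have hpos' : 0 < ln φ' (dir σ φ) := by
    rw [ln_dir_anti]; rw [ln_neg] at hpos; exact hpos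
  have hK : ∀ᶠ ab : ℝ × ℝ in 𝓝 (0, 0), ∀ k', k' ∉ {k | k ≠ i ∧ q ∈ c.CU k} → k' ≠ i →
      q - ab.1 • d + ab.2 • dir σ φ ∉ c.CU k' := by
    rw [Filter.eventually_all]
    intro k'
    by_cases hk' : q ∈ c.CU k'
    · refine Eventually.of_forall fun ab h1 h2 => absurd ⟨h2, hk'⟩ h1
    · have hcont : Tendsto (fun ab : ℝ × ℝ => q - ab.1 • d + ab.2 • dir σ φ) (𝓝 (0,0)) (𝓝 q) := by
        have : Continuous (fun ab : ℝ × ℝ => q - ab.1 • d + ab.2 • dir σ φ) := by fun_prop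
        simpa using this.tendsto (0,0)
      filter_upwards [hcont.eventually (avoid hk')] with ab h _ _ using h
  rw [Metric.eventually_nhds_iff] at hK
  obtain ⟨e0, he0, hK⟩ := hK
  have hI : ∀ a b : ℝ, 0 < b → q - a • d + b • dir σ φ ∉ c.CU i := by
    intro a b hb hmem
    have := hmem φ' hq.1
    rw [ev_add, ev_sub, ln_smul, ln_smul, hd, ln_dir_self, hq.2.1] at this
    nlinarith [mul_pos hb hpos']
  refine ⟨k, φ, hq, hφ, fun h => hkA.1 h.symm, hkA.2, h0, hext, hpos', ⟨e0, he0, ?_⟩, ⟨e0, he0, ?_⟩⟩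
  · intro a b ha ha' hb hb' k' hk'
    by_cases h1 : k' = i
    · subst h1; exact hI a b hb hk'
    by_cases h2 : k' ∈ {k | k ≠ i ∧ q ∈ c.CU k}
    · refine hsec k' h2 a b ha hb ?_
      convert hk' using 1; module
    · refine hK (y := (a, b)) ?_ k' h2 h1 hk'
      rw [Prod.dist_eq]
      simp [Real.dist_eq, abs_of_pos, ha, hb, ha', hb']
  · rintro b hb hb' ⟨k', hkk, hk'⟩
    by_cases h1 : k' = i
    · subst h1; refine hI 0 b hb ?_; simpa using hk'
    by_cases h2 : k' ∈ {k | k ≠ i ∧ q ∈ c.CU k}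
    · exact hray k' h2 hkk b hb hk'
    · refine hK (y := (0, b)) ?_ k' h2 h1 (by simpa using hk')
      rw [Prod.dist_eq]
      simp [Real.dist_eq, abs_of_pos, hb, hb', he0]

end Cake

namespace Cake

open Set Filter Topology
variable {ι : Type} [Fintype ι] {c : Cfg ι}

lemma par {φ χ : Fn} (hφ : φ.a ^ 2 + φ.b ^ 2 = 1) (h : ln χ (dir 1 φ) = 0) {q : ℝ × ℝ}
    (hq : ev φ q = 0) (z : ℝ × ℝ) :
    ev χ z = ev χ q + (χ.a * φ.a + χ.b * φ.b) * ev φ z := by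
  simp only [ln, dir] at h
  simp only [ev] at *
  have h3 : φ.a * (z.1 - q.1) + φ.b * (z.2 - q.2) = φ.a * z.1 + φ.b * z.2 + φ.c := by linarith
  rw [← h3]
  linear_combination (-(χ.a * (z.1-q.1) + χ.b*(z.2-q.2))) * hφ - (φ.b * (z.1 - q.1) - φ.a * (z.2-q.2)) * h

/-- separating functional for open convex disjoint sets -/
lemma sep_open {s t : Set (ℝ × ℝ)} (hs : Convex ℝ s) (hs' : IsOpen s) (ht : Convex ℝ t)
    (ht' : IsOpen t) (hd : Disjoint s t) : ∃ ψ : Fn, (∀ z ∈ s, ev ψ z < 0) ∧ ∀ z ∈ t, 0 < ev ψ z := by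
  obtain ⟨f, u, h1, h2⟩ := geometric_hahn_banach_open_open hs hs' ht ht' hd
  have key : ∀ z : ℝ × ℝ, ev ⟨f (1,0), f (0,1), -u⟩ z = f z - u := by
    intro z
    have : z = z.1 • (1,0) + z.2 • ((0,1) : ℝ × ℝ) := by ext <;> simp
    conv_rhs => rw [this, map_add, map_smul, map_smul]
    simp only [ev, smul_eq_mul]; ring
  refine ⟨⟨f (1,0), f (0,1), -u⟩, fun z hz => ?_, fun z hz => ?_⟩
  · rw [key]; linarith [h1 z hz]
  · rw [key]; linarith [h2 z hz]

def comb (s t : ℝ) (φ χ : Fn) : Fn := ⟨s * φ.a + t * χ.a, s * φ.b + t * χ.b, s * φ.c + t * χ.c⟩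
lemma ev_comb (s t : ℝ) (φ χ : Fn) (z : ℝ × ℝ) : ev (comb s t φ χ) z = s * ev φ z + t * ev χ z := by
  simp only [ev, comb]; ring
lemma ln_comb (s t : ℝ) (φ χ : Fn) (z : ℝ × ℝ) : ln (comb s t φ χ) z = s * ln φ z + t * ln χ z := by
  simp only [ln, comb]; ring

lemma CU_nonpos {k : ι} {φ : Fn} (h : ∀ z ∈ c.U k, ev φ z ≤ 0) {z : ℝ × ℝ} (hz : z ∈ c.CU k) :
    ev φ z ≤ 0 := by
  have := CU_nonneg (c := c) (k := k) (φ := comb (-1) 0 φ φ) (fun z hz => by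
    rw [ev_comb]; linarith [h z hz]) hz
  rw [ev_comb] at this; linarith

lemma rel_of_strict {i : ι} {φ : Fn} (hφ : φ ∈ c.cons i) {y : ℝ × ℝ} (h0 : ev φ y = 0)
    (h : ∀ η ∈ c.cons i, η ≠ φ → ev η y < 0) : c.Rel i φ y := by
  have hy : y ∈ c.CU i := fun η hη => by
    by_cases he : η = φ
    · rw [he, h0]
    · exact (h η hη he).le
  have hact : ∀ η ∈ c.cons i, ev η y = 0 → η = φ := fun η hη h1 => by
    by_contra he; exact (h η hη he).ne h1
  obtain ⟨ε, ⟨h1, h2⟩, h3⟩ := (((small_CU c (w := dir 1 φ) hy (fun η hη h1 => by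
      rw [hact η hη h1, ln_dir_self])).and
    (small_CU c (w := -dir 1 φ) hy (fun η hη h1 => by
      rw [hact η hη h1, ln_neg, ln_dir_self]; simp))).and self_mem_nhdsWithin).exists
  exact ⟨hφ, h0, ε, h3, h1, by rwa [smul_neg, ← sub_eq_add_neg] at h2⟩

lemma one_dim_le {α1 β1 α2 β2 : ℝ} (h1 : α1 = 0 → β1 ≤ 0) (h2 : α2 = 0 → β2 ≤ 0) :
    (∃ t : ℝ, α1 * t + β1 ≤ 0 ∧ α2 * t + β2 ≤ 0) ∨
    ∃ s : ℝ, 0 ≤ s ∧ s * α1 + α2 = 0 ∧ 0 < s * β1 + β2 := by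
  by_cases ha : α1 = 0
  · left
    have := h1 ha
    by_cases hb : α2 = 0
    · exact ⟨0, by simpa using this, by simpa using h2 hb⟩
    · exact ⟨-β2 / α2, by rw [ha]; simpa using this, by rw [mul_div_cancel₀ _ hb]; simp⟩
  by_cases hs : α2 / α1 ≤ 0
  · by_cases hc : α2 * (-β1 / α1) + β2 ≤ 0
    · left; exact ⟨-β1 / α1, by rw [mul_div_cancel₀ _ ha]; simp, hc⟩
    · right
      refine ⟨-(α2/α1), by linarith, by field_simp; ring, ?_⟩
      push Not at hc
      calc 0 < _ := hc
        _ = _ := by field_simp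
  · left
    push Not at hs
    have hb : α2 ≠ 0 := by rintro rfl; simp at hs
    rcases lt_or_gt_of_ne ha with h | h
    · have hb : α2 < 0 := by
        by_contra h'; push Not at h'
        exact absurd (div_nonpos_of_nonneg_of_nonpos h' h.le) (not_le.mpr hs)
      refine ⟨max (-β1/α1) (-β2/α2), ?_, ?_⟩
      · have := mul_le_mul_of_nonpos_left (le_max_left (-β1/α1) (-β2/α2)) h.le
        rw [mul_div_cancel₀ _ h.ne] at this; linarith
      · have := mul_le_mul_of_nonpos_left (le_max_right (-β1/α1) (-β2/α2)) hb.le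
        rw [mul_div_cancel₀ _ hb.ne] at this; linarith
    · have hb : 0 < α2 := by
        by_contra h'; push Not at h'
        exact absurd (div_nonpos_of_nonpos_of_nonneg h' h.le) (not_le.mpr hs)
      refine ⟨min (-β1/α1) (-β2/α2), ?_, ?_⟩
      · have := mul_le_mul_of_nonneg_left (min_le_left (-β1/α1) (-β2/α2)) h.le
        rw [mul_div_cancel₀ _ h.ne'] at this; linarith
      · have := mul_le_mul_of_nonneg_left (min_le_right (-β1/α1) (-β2/α2)) hb.le
        rw [mul_div_cancel₀ _ hb.ne'] at this; linarith

lemma one_dim_lt {α1 β1 α2 β2 : ℝ} (h1 : α1 = 0 → β1 ≤ 0) (h2 : β2 < 0) :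
    (∃ t : ℝ, α1 * t + β1 ≤ 0 ∧ α2 * t + β2 < 0) ∨
    ∃ s : ℝ, 0 ≤ s ∧ s * α1 + α2 = 0 ∧ 0 ≤ s * β1 + β2 := by
  by_cases ha : α1 = 0
  · left
    exact ⟨0, by simpa using h1 ha, by simpa using h2⟩
  by_cases hs : α2 / α1 ≤ 0
  · by_cases hc : α2 * (-β1 / α1) + β2 < 0
    · left; exact ⟨-β1 / α1, by rw [mul_div_cancel₀ _ ha]; simp, hc⟩
    · right
      refine ⟨-(α2/α1), by linarith, by field_simp; ring, ?_⟩
      push Not at hc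
      calc 0 ≤ _ := hc
        _ = _ := by field_simp
  · left
    push Not at hs
    rcases lt_or_gt_of_ne ha with h | h
    · have hb : α2 < 0 := by
        by_contra h'; push Not at h'
        exact absurd (div_nonpos_of_nonneg_of_nonpos h' h.le) (not_le.mpr hs)
      refine ⟨max (-β1/α1) 0, ?_, ?_⟩
      · have := mul_le_mul_of_nonpos_left (le_max_left (-β1/α1) 0) h.le
        rw [mul_div_cancel₀ _ h.ne] at this; linarith
      · have := mul_le_mul_of_nonpos_left (le_max_right (-β1/α1) 0) hb.le
        linarith
    · have hb : 0 < α2 := by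
        by_contra h'; push Not at h'
        exact absurd (div_nonpos_of_nonpos_of_nonneg h' h.le) (not_le.mpr hs)
      refine ⟨min (-β1/α1) 0, ?_, ?_⟩
      · have := mul_le_mul_of_nonneg_left (min_le_left (-β1/α1) 0) h.le
        rw [mul_div_cancel₀ _ h.ne'] at this; linarith
      · have := mul_le_mul_of_nonneg_left (min_le_right (-β1/α1) 0) hb.le
        linarith

lemma exists_psi {i k : ι} (hik : i ≠ k) {φ0 : Fn} {q0 : ℝ × ℝ} (hq0 : c.Rel i φ0 q0)
    (hfree : ∀ q, c.Rel i φ0 q → q ∉ c.CU k) :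
    ∃ ψ : Fn, (∀ z ∈ c.U i, ev ψ z < 0) ∧ ev ψ q0 < 0 ∧ ∀ z ∈ c.U k, 0 ≤ ev ψ z := by
  classical
  have hu := c.unit i φ0 hq0.1
  obtain ⟨ψ, hψ1, hψ2⟩ := sep_open (convex_U c i) (open_U c i) (convex_U c k) (open_U c k)
    (Set.disjoint_left.mpr fun p h1 h2 => disjU hik h1 h2)
  have hψq : ev ψ q0 ≤ 0 := CU_nonpos (fun z hz => (hψ1 z hz).le) hq0.mem
  rcases lt_or_eq_of_le hψq with h | hψ0
  · exact ⟨ψ, hψ1, h, fun z hz => (hψ2 z hz).le⟩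
  have hside : ∀ z ∈ c.U k, 0 < ev φ0 z := by
    have hd : ln ψ (dir 1 φ0) = 0 := by
      obtain ⟨_, _, ε, hε, e1, e2⟩ := hq0
      have a1 := CU_nonpos (fun z hz => (hψ1 z hz).le) e1
      have a2 := CU_nonpos (fun z hz => (hψ1 z hz).le) e2
      rw [ev_add, hψ0, ln_smul] at a1
      rw [ev_sub, hψ0, ln_smul] at a2
      apply le_antisymm
      · by_contra h; push Not at h; nlinarith [mul_pos hε h]
      · by_contra h; push Not at h; nlinarith [mul_pos hε (neg_pos.mpr h)]
    have hp := par hu hd hq0.2.1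
    rw [hψ0] at hp
    obtain ⟨p, hp'⟩ := c.ne i
    have b1 := hψ1 p hp'
    have b2 := hp' φ0 hq0.1
    rw [hp p] at b1
    intro z hz
    have b3 := hψ2 z hz
    rw [hp z] at b3
    have hμ : 0 < (ψ.a * φ0.a + ψ.b * φ0.b) := by
      by_contra h; push Not at h; nlinarith
    by_contra h; push Not at h; nlinarith
  by_contra hno
  push Not at hno
  set d := dir 1 φ0 with hd
  -- a functional parallel to the edge
  have hparallel : ∀ χ : Fn, ln χ d = 0 → (∀ z ∈ c.U k, ev χ z ≤ 0) → ev χ q0 ≤ 0 := by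
    intro χ h1 h2
    by_contra hpos
    push Not at hpos
    have hp := par hu h1 hq0.2.1
    obtain ⟨p, hp'⟩ := c.ne k
    have b1 := h2 p hp'
    have b2 := hside p hp'
    rw [hp p] at b1
    have hν : (χ.a * φ0.a + χ.b * φ0.b) < 0 := by
      by_contra h; push Not at h; nlinarith
    obtain ⟨z, hz, hlt⟩ := hno (comb (-1) 0 χ χ) (fun z hz => by
      rw [ev_comb, hp z]
      have := hz φ0 hq0.1
      nlinarith) (by rw [ev_comb]; linarith)
    rw [ev_comb] at hlt
    linarith [h2 z hz]
  have hsingle : ∀ χ ∈ c.cons k, ln χ d = 0 → ev χ q0 ≤ 0 := fun χ hχ h1 =>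
    hparallel χ h1 fun z hz => (hz χ hχ).le
  have hηq : ∀ η ∈ (c.cons i).erase φ0, ev η q0 < 0 := by
    intro η hη
    rw [Finset.mem_erase] at hη
    refine lt_of_le_of_ne (hq0.mem η hη.2) fun h => hη.1 (hq0.active hη.2 h)
  have hev : ∀ (χ : Fn) (t : ℝ), ev χ (q0 + t • d) = ln χ d * t + ev χ q0 := by
    intro χ t; rw [ev_add, ln_smul]; ring
  have pair1 : ∀ χ1 ∈ c.cons k, ∀ χ2 ∈ c.cons k, ∃ t : ℝ, ev χ1 (q0 + t • d) ≤ 0 ∧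
      ev χ2 (q0 + t • d) ≤ 0 := by
    intro χ1 h1 χ2 h2
    simp only [hev]
    rcases one_dim_le (hsingle χ1 h1) (hsingle χ2 h2) with h | ⟨s, hs, e1, e2⟩
    · exact h
    · exfalso
      have := hparallel (comb s 1 χ1 χ2) (by rw [ln_comb]; linarith) (fun z hz => by
        rw [ev_comb]
        have := hz χ1 h1
        have := hz χ2 h2
        nlinarith)
      rw [ev_comb] at this; linarith
  have pair2 : ∀ χ ∈ c.cons k, ∀ η ∈ (c.cons i).erase φ0, ∃ t : ℝ, ev χ (q0 + t • d) ≤ 0 ∧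
      ev η (q0 + t • d) < 0 := by
    intro χ h1 η h2
    simp only [hev]
    rcases one_dim_lt (hsingle χ h1) (hηq η h2) with h | ⟨s, hs, e1, e2⟩
    · exact h
    · exfalso
      have hp := par (χ := comb s 1 χ η) hu (by rw [ln_comb]; linarith) hq0.2.1
      have h3 := hηq η h2
      rw [Finset.mem_erase] at h2
      set ν := ((comb s 1 χ η).a * φ0.a + (comb s 1 χ η).b * φ0.b)
      obtain ⟨z, hz, hlt⟩ := hno (comb 1 |ν| η φ0) (fun z hz => by
        rw [ev_comb]
        have := hz φ0 hq0.1
        have := hz η h2.2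
        nlinarith [abs_nonneg ν]) (by rw [ev_comb, hq0.2.1]; linarith)
      have h5 := hp z
      rw [ev_comb, ev_comb] at h5
      rw [ev_comb] at hlt
      have h6 := hz χ h1
      have h7 := hside z hz
      have h8 : 0 ≤ (ν + |ν|) * ev φ0 z := mul_nonneg (by linarith [neg_abs_le ν]) h7.le
      nlinarith
  -- Helly
  let F : Fn ⊕ Fn → Set ℝ := Sum.elim (fun χ => {t | ev χ (q0 + t • d) ≤ 0})
    (fun η => {t | ev η (q0 + t • d) < 0})
  let J : Finset (Fn ⊕ Fn) := (c.cons k).disjSum ((c.cons i).erase φ0)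
  have pairs : ∀ x ∈ J, ∀ y ∈ J, (F x ∩ F y).Nonempty := by
    intro x hx y hy
    rw [Finset.mem_disjSum] at hx hy
    rcases hx with ⟨χ, h1, rfl⟩ | ⟨χ, h1, rfl⟩ <;> rcases hy with ⟨η, h2, rfl⟩ | ⟨η, h2, rfl⟩
    · exact pair1 χ h1 η h2
    · exact pair2 χ h1 η h2
    · obtain ⟨t, a, b⟩ := pair2 η h2 χ h1
      exact ⟨t, b, a⟩
    · refine ⟨0, ?_, ?_⟩
      · show ev χ (q0 + (0:ℝ) • d) < 0
        simpa using hηq χ h1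
      · show ev η (q0 + (0:ℝ) • d) < 0
        simpa using hηq η h2
  have hconv : ∀ x ∈ J, Convex ℝ (F x) := by
    have l1 : ∀ χ : Fn, (fun t : ℝ => q0 + t • d) = AffineMap.lineMap q0 (q0 + d) := by
      intro χ; funext t; rw [AffineMap.lineMap_apply]; simp [add_comm]
    rintro (χ | χ) _
    · have := (convex_ev_le χ).affine_preimage (AffineMap.lineMap q0 (q0 + d))
      rw [← l1 χ] at this; exact this
    · have := (convex_ev_lt χ).affine_preimage (AffineMap.lineMap q0 (q0 + d))
      rw [← l1 χ] at this; exact this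
  have hH := Convex.helly_theorem' (𝕜 := ℝ) (s := J) (F := F) hconv (by
    intro I hI hcard
    rw [Module.finrank_self] at hcard
    rcases Finset.eq_empty_or_nonempty I with rfl | ⟨x, hx⟩
    · simp
    · obtain ⟨y, hy⟩ : ∃ y ∈ J, I ⊆ {x, y} := by
        rcases Finset.eq_empty_or_nonempty (I.erase x) with h | ⟨y, hy⟩
        · refine ⟨x, hI hx, ?_⟩
          rw [Finset.erase_eq_empty_iff] at h
          rcases h with rfl | rfl
          · simp
          · simp
        · refine ⟨y, hI (Finset.mem_of_mem_erase hy), ?_⟩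
          have h1 : (I.erase x).card ≤ 1 := by
            rw [Finset.card_erase_of_mem hx]; omega
          intro z hz
          by_cases hzx : z = x
          · simp [hzx]
          · have := Finset.card_le_one.mp h1 z (Finset.mem_erase.mpr ⟨hzx, hz⟩) y hy
            simp [this]
      obtain ⟨t, ht1, ht2⟩ := pairs x (hI hx) y hy.1
      refine ⟨t, ?_⟩
      rw [mem_iInter₂]
      intro z hz
      have := hy.2 hz
      simp only [Finset.mem_insert, Finset.mem_singleton] at this
      rcases this with rfl | rfl
      · exact ht1
      · exact ht2)
  obtain ⟨t, ht⟩ := hH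
  rw [mem_iInter₂] at ht
  refine hfree (q0 + t • d) (rel_of_strict hq0.1 ?_ ?_) ?_
  · rw [ev_add, ln_smul, hd, ln_dir_self, hq0.2.1]; simp
  · intro η hη hne
    exact ht (Sum.inr η) (by
      rw [Finset.mem_disjSum]; right; exact ⟨η, Finset.mem_erase.mpr ⟨hne, hη⟩, rfl⟩)
  · intro χ hχ
    exact ht (Sum.inl χ) (by
      rw [Finset.mem_disjSum]; left; exact ⟨χ, hχ, rfl⟩)

/-- (E) every edge is touched at a relative interior point. -/
lemma edge_touched {i : ι} {φ0 : Fn} {q0 : ℝ × ℝ} (hq0 : c.Rel i φ0 q0) :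
    ∃ q, c.Rel i φ0 q ∧ c.Tch i q := by
  by_contra hno
  push Not at hno
  have : ∀ k : ι, ∃ ψ : Fn, k ≠ i → (∀ z ∈ c.U i, ev ψ z < 0) ∧ ev ψ q0 < 0 ∧
      ∀ z ∈ c.U k, 0 ≤ ev ψ z := by
    intro k
    by_cases hk : k = i
    · exact ⟨⟨0,0,0⟩, fun h => absurd hk h⟩
    · obtain ⟨ψ, h⟩ := exists_psi (Ne.symm hk) hq0 (fun q hq hqk => hno q hq ⟨k, hk, hqk⟩)
      exact ⟨ψ, fun _ => h⟩
  choose Ψ hΨ using this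
  have hV := c.maxl i (⋂ k : {k // k ≠ i}, {p | ev (Ψ k) p < 0})
    (isOpen_iInter_of_finite fun k => isOpen_lt (ev_continuous _) continuous_const)
    (convex_iInter fun k => convex_ev_lt _)
    (fun p hp => mem_iInter.mpr fun k => (hΨ k k.2).1 p hp)
    (fun j hj p hp hpj => by
      have h1 := mem_iInter.mp hp ⟨j, hj⟩
      have h2 := (hΨ j hj).2.2 p hpj
      exact absurd h1 (not_lt.mpr h2))
    q0 (mem_iInter.mpr fun k => (hΨ k k.2).2.1) φ0 hq0.1
  exact hV.ne hq0.2.1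

end Cake

namespace Cake

open Set Filter Topology
variable {ι : Type} [Fintype ι] {c : Cfg ι}

lemma first_touch {σ : ℝ} (hσ : σ * σ = 1) {i : ι} {φ : Fn} {y q1 : ℝ × ℝ} (hy : c.Rel i φ y)
    (hq1 : c.Rel i φ q1) (hy' : ¬ c.Tch i y) (hq1' : c.Tch i q1) (hlt : tc σ φ y < tc σ φ q1) :
    ∃ q, c.Rel i φ q ∧ c.Tch i q ∧ tc σ φ y < tc σ φ q ∧
      ∀ z, c.Rel i φ z → tc σ φ y ≤ tc σ φ z → tc σ φ z < tc σ φ q → ¬ c.Tch i z := by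
  have hu := c.unit i φ hy.1
  set S : Set ℝ := Icc 0 1 ∩ ⋃ k : {k // k ≠ i}, (fun s : ℝ => y + s • (q1 - y)) ⁻¹' c.CU k with hS
  have hcomp : IsCompact S := isCompact_Icc.inter_right
    (isClosed_iUnion_of_finite fun k => (closed_CU c k).preimage (by fun_prop))
  have hmem : ∀ s, s ∈ S ↔ (0 ≤ s ∧ s ≤ 1) ∧ c.Tch i (y + s • (q1 - y)) := by
    intro s
    simp only [hS, mem_inter_iff, mem_Icc, mem_iUnion, mem_preimage, Cfg.Tch, Subtype.exists,
      exists_prop]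
  have hne : S.Nonempty := ⟨1, (hmem 1).mpr ⟨⟨by norm_num, le_rfl⟩, by simpa using hq1'⟩⟩
  obtain ⟨s, hs, hmin⟩ := hcomp.exists_isLeast hne
  obtain ⟨⟨hs0, hs1⟩, hst⟩ := (hmem s).mp hs
  have hspos : 0 < s := by
    rcases eq_or_lt_of_le hs0 with h | h
    · subst h; simp at hst; exact absurd hst hy'
    · exact h
  have htc : ∀ s : ℝ, tc σ φ (y + s • (q1 - y)) = tc σ φ y + s * (tc σ φ q1 - tc σ φ y) := by
    intro s; rw [tc_add, tc_smul, tc_sub]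
  have hD : 0 < tc σ φ q1 - tc σ φ y := by linarith
  refine ⟨_, hy.seg hq1 hs0 hs1, hst, ?_, ?_⟩
  · rw [htc]; nlinarith [mul_pos hspos hD]
  · intro z hz h1 h2 ht
    rw [htc] at h2
    have e1 := on_line hσ hu hz.2.1 hy.2.1
    have e2 := on_line hσ hu hq1.2.1 hy.2.1
    set D := tc σ φ q1 - tc σ φ y
    set t := (tc σ φ z - tc σ φ y) / D
    have e3 : q1 - y = D • dir σ φ := by nth_rewrite 1 [e2]; module
    have hz' : z = y + t • (q1 - y) := by
      rw [e3, smul_smul, div_mul_cancel₀ _ hD.ne']; exact e1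
    have ht0 : 0 ≤ t := div_nonneg (by linarith) hD.le
    have hts : t < s := by rw [div_lt_iff₀ hD]; linarith
    have := hmin ((hmem t).mpr ⟨⟨ht0, by linarith⟩, hz' ▸ ht⟩)
    linarith

lemma next_link {σ : ℝ} (hσ : σ * σ = 1) {i : ι} {φ : Fn} (h : c.State σ i φ) :
    ∃ k φ2 v, Link c σ i φ k φ2 v := by
  obtain ⟨hφ, y, hy, hyf⟩ := h
  obtain ⟨q1, hq1, hq1'⟩ := edge_touched hy
  have hlt : tc σ φ y < tc σ φ q1 := by
    by_contra h; push Not at h; exact hyf q1 hq1 h hq1'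
  obtain ⟨q, hq, hqt, hyq, hfree⟩ := first_touch hσ hy hq1 (hyf y hy le_rfl) hq1' hlt
  obtain ⟨k, φ2, hl⟩ := step hσ hq hqt hy hyq hfree
  refine ⟨k, φ2, q, hl, fun z hz hlt => ?_⟩
  by_cases h : tc σ φ y ≤ tc σ φ z
  · exact hfree z hz h hlt
  · exact hyf z hz (by linarith)

/-- F1 : every state has a predecessor. -/
lemma pred_link {σ : ℝ} (hσ : σ * σ = 1) {k : ι} {φ : Fn} (h : c.State σ k φ) :
    ∃ i φ' v, Link c σ i φ' k φ v := by
  let S := {x : ι × Fn // c.State σ x.1 x.2}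
  have hfin : Finite S := by
    have : ({x : ι × Fn | c.State σ x.1 x.2}).Finite := by
      apply Set.Finite.subset (s := ⋃ i : ι, (fun φ => (i, φ)) '' (c.cons i : Set Fn))
      · exact Set.finite_iUnion fun i => (Finset.finite_toSet _).image _
      · rintro ⟨i, χ⟩ hx
        exact mem_iUnion.mpr ⟨i, χ, hx.1, rfl⟩
    exact this.to_subtype
  have hex : ∀ x : S, ∃ y : S, ∃ v, Link c σ x.1.1 x.1.2 y.1.1 y.1.2 v := by
    rintro ⟨⟨i, χ⟩, hx⟩
    obtain ⟨k, φ2, v, hl⟩ := next_link hσ hx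
    exact ⟨⟨(k, φ2), hl.toLinkL.state hσ⟩, v, hl⟩
  choose f hf using hex
  have hinj : Function.Injective f := by
    intro x y hxy
    obtain ⟨v, h1⟩ := hf x
    obtain ⟨v2, h2⟩ := hf y
    rw [← hxy] at h2
    obtain ⟨a, b, _⟩ := Link.inj hσ h1.toLinkL h2.toLinkL
    exact Subtype.ext (Prod.ext a b)
  obtain ⟨x, hx⟩ := Finite.surjective_of_injective hinj ⟨(k, φ), h⟩
  obtain ⟨v, hl⟩ := hf x
  rw [hx] at hl
  exact ⟨_, _, v, hl⟩

def crf (σ : ℝ) (w v : ℝ × ℝ) : Fn := ⟨-(σ * w.2), σ * w.1, -(σ * cr w v)⟩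
lemma ev_crf (σ : ℝ) (w v z : ℝ × ℝ) : ev (crf σ w v) z = σ * cr w (z - v) := by
  simp only [ev, crf, cr, Prod.fst_sub, Prod.snd_sub]; ring

lemma tip {σ : ℝ} (hσ : σ * σ = 1) (v w0 : ℝ × ℝ) (hne : ∃ k, v ∈ c.CU k)
    (hA : ∀ k, v ∈ c.CU k → (∀ z ∈ c.U k, 0 < σ * cr w0 (z - v)) ∧
      ∀ ε : ℝ, 0 < ε → v + ε • w0 ∉ c.CU k) : False := by
  obtain ⟨k, hk, φ, hφ, h0, hpos, ⟨b0, hb0, hb⟩, hsec, hray⟩ := local_first c hσ v w0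
    {k | v ∈ c.CU k} hne (fun k hk => ⟨hk, (hA k hk).1, (hA k hk).2⟩)
  have hu := c.unit k φ hφ
  have hcr : ∀ z ∈ c.CU k, 0 ≤ σ * cr w0 (z - v) := by
    intro z hz
    rw [← ev_crf]
    exact CU_nonneg (fun z hz => by rw [ev_crf]; exact ((hA k hk).1 z hz).le) hz
  have hcd : ∀ s : ℝ, σ * cr w0 (v + s • dir σ φ - v) = s * ln φ w0 := by
    intro s
    rw [add_sub_cancel_left, cr_smul, cr_dir]; linear_combination (s * ln φ w0) * hσ
  have hs0 : ∀ s : ℝ, v + s • dir σ φ ∈ c.CU k → 0 ≤ s := by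
    intro s hs
    have := hcr _ hs
    rw [hcd] at this
    by_contra h; push Not at h; nlinarith
  have hsmall : ∀ᶠ s in 𝓝 (0 : ℝ), ∀ k', v ∉ c.CU k' → v + s • dir σ φ ∉ c.CU k' := by
    rw [Filter.eventually_all]
    intro k'
    by_cases hk' : v ∈ c.CU k'
    · exact Eventually.of_forall fun s h => absurd hk' h
    · have hcont : Tendsto (fun s : ℝ => v + s • dir σ φ) (𝓝 0) (𝓝 v) := by
        have : Continuous (fun s : ℝ => v + s • dir σ φ) := by fun_prop
        simpa using this.tendsto 0
      filter_upwards [hcont.eventually (avoid hk')] with s h _ using h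
  rw [Metric.eventually_nhds_iff] at hsmall
  obtain ⟨e0, he0, hK⟩ := hsmall
  have hrel : ∀ s, 0 < s → s < b0 → c.Rel k φ (v + s • dir σ φ) := by
    intro s h1 h2
    refine Cfg.Rel.of_dirs hφ ?_ hσ (e1 := b0 - s) (e2 := s) (by linarith) h1 ?_ ?_
    · rw [ev_add, ln_smul, ln_dir_self, h0]; simp
    · convert hb using 1; module
    · rw [add_sub_cancel_right]; exact hk
  have hm : 0 < min b0 e0 := lt_min hb0 he0
  have hst : c.State σ k φ := by
    refine ⟨hφ, v + (min b0 e0 / 2) • dir σ φ, hrel _ (by linarith)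
      (by have := min_le_left b0 e0; linarith), ?_⟩
    rintro z hz ht ⟨k', hkk, hk'⟩
    have hz' := on_line hσ hu hz.2.1 h0
    set s := tc σ φ z - tc σ φ v with hs
    rw [tc_add, tc_smul, tc_dir hσ hu] at ht
    have hspos : 0 < s := by
      obtain ⟨ε, hε, _, h2⟩ := hz.dirs hσ
      have : v + (s - ε) • dir σ φ ∈ c.CU k := by
        convert h2 using 1
        nth_rewrite 1 [hz']; module
      have := hs0 _ this
      linarith
    rw [hz'] at hk'
    have h3 := min_le_right b0 e0
    by_cases hv : v ∈ c.CU k'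
    · exact hray k' hv hkk s hspos hk'
    · refine hK (y := s) ?_ k' hv hk'
      rw [Real.dist_eq, sub_zero, abs_of_pos hspos]
      linarith
  obtain ⟨i, φ', v2, hl⟩ := pred_link hσ hst
  have hv : v2 = v := by
    have e := on_line hσ hu hl.v0 h0
    have e2 := on_line hσ hu h0 hl.v0
    have a1 := hs0 _ (e ▸ hl.vk)
    have a2 := hl.toLinkL.after (e2 ▸ hk)
    have : tc σ φ v2 - tc σ φ v = 0 := by linarith
    rw [this] at e; simpa using e
  subst hv
  have hvi := hl.rel.mem
  by_cases hw : ln φ' w0 ≤ 0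
  · obtain ⟨ε, h1, h2⟩ := ((hl.rel.half' hw).and self_mem_nhdsWithin).exists
    exact (hA i hvi).2 ε h2 h1
  · push Not at hw
    have hw' : ln φ' (-w0) < 0 := by rw [ln_neg]; linarith
    obtain ⟨ε, h1⟩ := (hl.rel.half hw').exists
    have := (hA i hvi).1 _ h1
    rw [add_sub_cancel_left, cr_smul, cr_neg, cr_self] at this
    simp at this

/-- strictness from openness -/
lemma cr_strict {σ : ℝ} (hσ : σ * σ = 1) {k : ι} {w v : ℝ × ℝ} (hw : w ≠ 0)
    (h : ∀ z ∈ c.U k, 0 ≤ σ * cr w (z - v)) : ∀ z ∈ c.U k, 0 < σ * cr w (z - v) := by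
  intro z hz
  obtain ⟨ε, h1, h3⟩ := ((U_move hz (σ * w.2, -σ * w.1)).and self_mem_nhdsWithin).exists
  have h3 : 0 < ε := h3
  have := h _ h1
  have e : σ * cr w (z + ε • (σ * w.2, -σ * w.1) - v) = σ * cr w (z - v) - ε * (w.1^2+w.2^2) := by
    simp only [cr, Prod.fst_sub, Prod.snd_sub, Prod.fst_add, Prod.snd_add, Prod.smul_fst,
      Prod.smul_snd, smul_eq_mul]
    linear_combination (-ε * (w.1^2+w.2^2)) * hσ
  rw [e] at this
  have hp : 0 < w.1^2+w.2^2 := by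
    by_contra hn
    apply hw
    have a1 : w.1 = 0 := by nlinarith [sq_nonneg w.1, sq_nonneg w.2]
    have a2 : w.2 = 0 := by nlinarith [sq_nonneg w.1, sq_nonneg w.2]
    exact Prod.ext a1 a2
  nlinarith [mul_pos h3 hp]

variable (c)
/-- `p` and `q` see each other in the complement. -/
def Cfg.See (p q : ℝ × ℝ) : Prop := ∀ s : ℝ, 0 ≤ s → s ≤ 1 → p + s • (q - p) ∈ c.K
variable {c}

lemma See.symm {p q : ℝ × ℝ} (h : c.See p q) : c.See q p := by
  intro s h0 h1
  have := h (1 - s) (by linarith) (by linarith)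
  convert this using 1; module

lemma See.trans {p q r : ℝ × ℝ} (h1 : c.See p q) (h2 : c.See q r) : c.See p r := by
  set A := q - p with hA
  set B := r - q with hB
  by_cases hD : cr A B = 0
  · -- collinear
    intro l hl0 hl1
    by_cases hA0 : A = 0
    · have : p = q := by rw [hA, sub_eq_zero] at hA0; exact hA0.symm
      rw [this]; exact h2 l hl0 hl1
    obtain ⟨t, ht⟩ : ∃ t : ℝ, B = t • A := by
      have hp : 0 < A.1^2+A.2^2 := by
        by_contra hn
        apply hA0
        have a1 : A.1 = 0 := by nlinarith [sq_nonneg A.1, sq_nonneg A.2]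
        have a2 : A.2 = 0 := by nlinarith [sq_nonneg A.1, sq_nonneg A.2]
        exact Prod.ext a1 a2
      refine ⟨(A.1 * B.1 + A.2 * B.2) / (A.1^2+A.2^2), ?_⟩
      simp only [cr] at hD
      ext
      · simp only [Prod.smul_fst, smul_eq_mul]; field_simp; linear_combination (-A.2) * hD
      · simp only [Prod.smul_snd, smul_eq_mul]; field_simp; linear_combination (A.1) * hD
    have hr : r - p = (1 + t) • A := by
      have : r - p = A + B := by rw [hA, hB]; module
      rw [this, ht]; module
    have hq : q = p + A := by rw [hA]; module
    set s := l * (1 + t) with hs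
    have hx : p + l • (r - p) = p + s • A := by rw [hr, smul_smul]
    rw [hx]
    by_cases c1 : 0 ≤ s ∧ s ≤ 1
    · exact h1 s c1.1 c1.2
    by_cases c2 : 1 < s
    · have ht0 : 0 < t := by nlinarith
      have := h2 ((s - 1) / t) (div_nonneg (by linarith) ht0.le)
        (by rw [div_le_one ht0]; nlinarith)
      rw [← hB, ht, smul_smul, div_mul_cancel₀ _ ht0.ne', hq] at this
      convert this using 1; module
    · have hs0 : s < 0 := by
        by_contra h; push Not at h c2; exact c1 ⟨h, c2⟩
      have ht0 : t < -1 := by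
        by_contra h; push Not at h
        have := mul_nonneg hl0 (by linarith : (0:ℝ) ≤ 1 + t)
        linarith
      have := h2 ((s - 1) / t) (div_nonneg_of_nonpos (by linarith) (by linarith))
        (by rw [div_le_one_of_neg (by linarith)]; nlinarith)
      rw [← hB, ht, smul_smul, div_mul_cancel₀ _ (by linarith), hq] at this
      convert this using 1; module
  · -- noncollinear
    by_contra hcon
    have hcon' : ∃ l : ℝ, 0 ≤ l ∧ l ≤ 1 ∧ ∃ k, p + l • (A + B) ∈ c.CU k := by
      simp only [Cfg.See, Cfg.K, mem_ofPred_eq] at hcon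
      push Not at hcon
      obtain ⟨l, a, b, k, hk⟩ := hcon
      refine ⟨l, a, b, k, ?_⟩
      convert hk using 3; rw [hA, hB]; module
    let P : ℝ → ℝ → ℝ × ℝ := fun τ l => p + l • (A + τ • B)
    set S : Set (ℝ × ℝ) := (Icc 0 1 ×ˢ Icc 0 1) ∩ ⋃ k : ι, (fun x : ℝ × ℝ => P x.1 x.2) ⁻¹' c.CU k
      with hS
    have hSc : IsCompact S := (isCompact_Icc.prod isCompact_Icc).inter_right
      (isClosed_iUnion_of_finite fun k => (closed_CU c k).preimage (by fun_prop))
    have hmem : ∀ τ l, (τ, l) ∈ S ↔ ((0 ≤ τ ∧ τ ≤ 1) ∧ (0 ≤ l ∧ l ≤ 1)) ∧ ∃ k, P τ l ∈ c.CU k := by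
      intro τ l
      simp only [hS, mem_inter_iff, mem_prod, mem_Icc, mem_iUnion, mem_preimage]
    have hSne : S.Nonempty := by
      obtain ⟨l, a, b, k, hk⟩ := hcon'
      exact ⟨(1, l), (hmem 1 l).mpr ⟨⟨⟨by norm_num, le_rfl⟩, a, b⟩, k, by simpa [P] using hk⟩⟩
    obtain ⟨⟨τ, l1⟩, hτS, hτmin⟩ := hSc.exists_isMinOn hSne continuous_fst.continuousOn
    obtain ⟨⟨τ', l⟩, ⟨hlS, hlτ⟩, hlmin⟩ := (hSc.inter_right (isClosed_eq continuous_fst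
      (continuous_const (y := τ)))).exists_isMinOn ⟨(τ, l1), hτS, rfl⟩ continuous_snd.continuousOn
    have hlτ : τ' = τ := hlτ
    subst hlτ
    obtain ⟨⟨⟨t0, t1⟩, l0, l1'⟩, hk0⟩ := (hmem _ _).mp hlS
    have minτ : ∀ t s, (t, s) ∈ S → τ' ≤ t := fun t s h => hτmin h
    have minl : ∀ s, (τ', s) ∈ S → l ≤ s := fun s h => hlmin ⟨h, rfl⟩
    have hlpos : 0 < l := by
      rcases eq_or_lt_of_le l0 with h | h
      · subst h
        obtain ⟨k, hk⟩ := hk0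
        have := h1 0 le_rfl zero_le_one k
        simp [P] at hk this
        exact absurd hk this
      · exact h
    have hlt1 : l < 1 := by
      rcases eq_or_lt_of_le l1' with h | h
      · subst h
        obtain ⟨k, hk⟩ := hk0
        refine absurd ?_ (h2 τ' t0 t1 k)
        convert hk using 1
        simp only [P, hA, hB]; module
      · exact h
    have hτpos : 0 < τ' := by
      rcases eq_or_lt_of_le t0 with h | h
      · obtain ⟨k, hk⟩ := hk0
        refine absurd ?_ (h1 l l0 l1' k)
        convert hk using 1
        simp only [P, ← h, hA]; module
      · exact h
    set D := cr A B with hDdef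
    obtain ⟨σ, hσ, hσD⟩ : ∃ σ : ℝ, σ * σ = 1 ∧ 0 < -(σ * D) := by
      rcases lt_or_gt_of_ne hD with h | h
      · exact ⟨1, by norm_num, by linarith⟩
      · exact ⟨-1, by norm_num, by linarith⟩
    set w0 := -(A + τ' • B) with hw0
    have hw0ne : w0 ≠ 0 := by
      intro h
      have h3 : cr w0 B = 0 := by rw [h]; simp [cr]
      have h4 : cr w0 B = - D := by simp [hw0, hDdef, cr]; ring
      rw [h3] at h4; exact hD (by linarith)
    refine tip (c := c) hσ (P τ' l) w0 hk0 ?_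
    intro k hk
    constructor
    · refine cr_strict hσ hw0ne ?_
      intro z hz
      by_contra hneg
      push Not at hneg
      set x := z - P τ' l with hx
      set α := cr x B / D with hα
      set β := cr A x / D with hβ
      have hxe : x = α • A + β • B := by
        ext
        · simp only [hα, hβ, Prod.fst_add, Prod.smul_fst, smul_eq_mul]
          field_simp; simp only [hDdef, cr]; ring
        · simp only [hα, hβ, Prod.snd_add, Prod.smul_snd, smul_eq_mul]
          field_simp; simp only [hDdef, cr]; ring
      have hβα : β < τ' * α := by
        have e : σ * cr w0 x = -(σ * D) * (β - τ' * α) := by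
          rw [hxe]; simp only [hw0, hDdef, cr, Prod.fst_neg, Prod.snd_neg, Prod.fst_add, Prod.snd_add,
            Prod.smul_fst, Prod.smul_snd, smul_eq_mul]; ring
        rw [e] at hneg
        by_contra h; push Not at h
        nlinarith [mul_nonneg hσD.le (by linarith : 0 ≤ β - τ' * α)]
      have c1 : ∀ᶠ ε in 𝓝[>] (0:ℝ), 0 < l + ε * α := by
        have : Tendsto (fun ε : ℝ => l + ε * α) (𝓝[>] 0) (𝓝 l) := by
          have : Continuous (fun ε : ℝ => l + ε * α) := by fun_prop
          have := this.tendsto 0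
          simp at this; exact this.mono_left nhdsWithin_le_nhds
        exact this.eventually (lt_mem_nhds hlpos)
      have c2 : ∀ᶠ ε in 𝓝[>] (0:ℝ), l + ε * α < 1 := by
        have : Tendsto (fun ε : ℝ => l + ε * α) (𝓝[>] 0) (𝓝 l) := by
          have : Continuous (fun ε : ℝ => l + ε * α) := by fun_prop
          have := this.tendsto 0
          simp at this; exact this.mono_left nhdsWithin_le_nhds
        exact this.eventually (gt_mem_nhds hlt1)
      have c3 : ∀ᶠ ε in 𝓝[>] (0:ℝ), 0 < l * τ' + ε * β := by
        have : Tendsto (fun ε : ℝ => l * τ' + ε * β) (𝓝[>] 0) (𝓝 (l * τ')) := by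
          have : Continuous (fun ε : ℝ => l * τ' + ε * β) := by fun_prop
          have := this.tendsto 0
          simp at this; exact this.mono_left nhdsWithin_le_nhds
        exact this.eventually (lt_mem_nhds (mul_pos hlpos hτpos))
      obtain ⟨ε, ⟨⟨⟨a1, a2⟩, a3⟩, a4⟩, a5⟩ :=
        ((((c1.and c2).and c3).and ev01).and self_mem_nhdsWithin).exists
      have a5 : 0 < ε := a5
      have hin := U_sub_CU c k (mem_U_of_CU c hk hz a5 a4)
      set τ2 := (l * τ' + ε * β) / (l + ε * α) with hτ2
      have b1 : 0 ≤ τ2 := (div_pos a3 a1).le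
      have b2 : τ2 < τ' := by
        rw [hτ2, div_lt_iff₀ a1]; nlinarith
      have hP : P τ2 (l + ε * α) = P τ' l + ε • (z - P τ' l) := by
        rw [← hx, hxe]
        have : (l + ε * α) * τ2 = l * τ' + ε * β := by rw [hτ2]; field_simp
        simp only [P, smul_add, smul_smul, this]
        module
      have := minτ τ2 (l + ε * α) ((hmem _ _).mpr ⟨⟨⟨b1, by linarith⟩, a1.le, a2.le⟩, k, by
        rw [hP]; exact hin⟩)
      linarith
    · intro ε hε hmemk
      have hm : 0 < min ε (l / 2) := lt_min hε (by linarith)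
      have h3 := CU_ray hk hmemk hm.le (min_le_left _ _)
      have h4 : min ε (l/2) ≤ l / 2 := min_le_right _ _
      have hP : P τ' (l - min ε (l/2)) = P τ' l + min ε (l/2) • w0 := by
        simp only [P, hw0]; module
      have := minl (l - min ε (l/2)) ((hmem _ _).mpr ⟨⟨⟨t0, t1⟩, by linarith, by linarith⟩, k, by
        rw [hP]; exact h3⟩)
      linarith

variable (c)
/-- holes -/
def Cfg.IsHole (H : Set (ℝ × ℝ)) : Prop := ∃ p ∈ c.K, H = {q | c.See p q}
variable {c}

lemma See.refl {p : ℝ × ℝ} (hp : p ∈ c.K) : c.See p p := by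
  intro s _ _; simpa using hp

lemma See.of_convex {N : Set (ℝ × ℝ)} (hN : Convex ℝ N) (hK : N ⊆ c.K) {x y : ℝ × ℝ} (hx : x ∈ N)
    (hy : y ∈ N) : c.See x y := by
  intro s h0 h1
  apply hK
  have := hN hx hy (by linarith : 0 ≤ 1 - s) h0 (by ring)
  convert this using 1; module

lemma See.right {p q : ℝ × ℝ} (h : c.See p q) : q ∈ c.K := by
  have := h 1 zero_le_one le_rfl
  simpa using this

lemma Cfg.IsHole.sub {H : Set (ℝ × ℝ)} (h : c.IsHole H) : H ⊆ c.K := by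
  obtain ⟨p, hp, rfl⟩ := h
  intro q hq; exact See.right hq

lemma Cfg.IsHole.absorb {H : Set (ℝ × ℝ)} (h : c.IsHole H) {N : Set (ℝ × ℝ)} (hN : Convex ℝ N)
    (hK : N ⊆ c.K) {x : ℝ × ℝ} (hx : x ∈ N) (hxH : x ∈ H) : N ⊆ H := by
  obtain ⟨p, hp, rfl⟩ := h
  intro y hy
  exact See.trans hxH (See.of_convex hN hK hx hy)

lemma Cfg.IsHole.nonempty {H : Set (ℝ × ℝ)} (h : c.IsHole H) : H.Nonempty := by
  obtain ⟨p, hp, rfl⟩ := h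
  exact ⟨p, See.refl hp⟩

lemma Cfg.IsHole.isOpen {H : Set (ℝ × ℝ)} (h : c.IsHole H) : IsOpen H := by
  rw [Metric.isOpen_iff]
  intro x hx
  obtain ⟨e, he, hb⟩ := Metric.isOpen_iff.mp (open_K c) x (h.sub hx)
  exact ⟨e, he, h.absorb (convex_ball x e) hb (Metric.mem_ball_self he) hx⟩

lemma Cfg.IsHole.convex {H : Set (ℝ × ℝ)} (h : c.IsHole H) : Convex ℝ H := by
  rw [convex_iff_segment_subset]
  intro x hx y hy
  have hxy : c.See x y := by
    obtain ⟨p, hp, rfl⟩ := h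
    exact See.trans (See.symm hx) hy
  refine h.absorb (convex_segment x y) ?_ (left_mem_segment ℝ x y) hx
  intro z hz
  rw [segment_eq_image'] at hz
  obtain ⟨t, ht, rfl⟩ := hz
  exact hxy t ht.1 ht.2

lemma hole_eq {H H' : Set (ℝ × ℝ)} (h : c.IsHole H) (h' : c.IsHole H') {x : ℝ × ℝ} (hx : x ∈ H)
    (hx' : x ∈ H') : H = H' :=
  Subset.antisymm (h'.absorb h.convex h.sub hx hx') (h.absorb h'.convex h'.sub hx' hx)

lemma hole_of {p : ℝ × ℝ} (hp : p ∈ c.K) : ∃ H, c.IsHole H ∧ p ∈ H :=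
  ⟨_, ⟨p, hp, rfl⟩, See.refl hp⟩

end Cake

namespace Cake

open Set Filter Topology
variable {ι : Type} [Fintype ι] {c : Cfg ι}

variable (c)
def Cfg.Adj (σ : ℝ) (H : Set (ℝ × ℝ)) (k : ι) (φ : Fn) : Prop :=
  ∃ y, c.Rel k φ y ∧ (∀ z, c.Rel k φ z → tc σ φ z ≤ tc σ φ y → ¬ c.Tch k z) ∧ y ∈ closure H
variable {c}

lemma Cfg.Adj.state {σ : ℝ} {H : Set (ℝ × ℝ)} {k : ι} {φ : Fn} (h : c.Adj σ H k φ) :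
    c.State σ k φ := by
  obtain ⟨y, h1, h2, _⟩ := h
  exact ⟨h1.1, y, h1, h2⟩

lemma open_push {H : Set (ℝ × ℝ)} (hH : IsOpen H) (hc : Convex ℝ H) {y z : ℝ × ℝ}
    (hy : y ∈ closure H) (hz : z ∈ H) {t : ℝ} (h0 : 0 < t) (h1 : t ≤ 1) :
    y + t • (z - y) ∈ H := by
  have := hc.add_smul_sub_mem_interior' hy (hH.interior_eq.symm ▸ hz) (t := t) ⟨h0, h1⟩
  rwa [hH.interior_eq] at this

lemma hole_side {H : Set (ℝ × ℝ)} (hH : c.IsHole H) {i : ι} {φ : Fn} {y : ℝ × ℝ}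
    (hy : c.Rel i φ y) (hyH : y ∈ closure H) {z : ℝ × ℝ} (hz : z ∈ H) : 0 < ev φ z := by
  by_contra h
  push Not at h
  have hw : ln φ (z - y) ≤ 0 := by rw [ln_sub_pts, hy.2.1]; linarith
  obtain ⟨ε, ⟨h1, h2⟩, h3⟩ := (((hy.half' hw).and ev01).and self_mem_nhdsWithin).exists
  exact hH.sub (open_push hH.isOpen hH.convex hyH hz h3 h2) i h1

/-- a convex neighbourhood of an untouched edge piece -/
lemma tube_aux {i : ι} {φ : Fn} (hφ : φ ∈ c.cons i) {y y' : ℝ × ℝ}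
    (hfree : ∀ s : ℝ, 0 ≤ s → s ≤ 1 → ¬ c.Tch i (y + s • (y' - y))) :
    ∃ N : Set (ℝ × ℝ), IsOpen N ∧ Convex ℝ N ∧ y ∈ N ∧ y' ∈ N ∧
      ∀ p ∈ N, 0 < ev φ p → p ∈ c.K := by
  set O : Set (ℝ × ℝ) := ⋂ k : {k // k ≠ i}, (c.CU k)ᶜ
  have hO : IsOpen O := isOpen_iInter_of_finite fun k => (closed_CU c k).isOpen_compl
  have hsub : segment ℝ y y' ⊆ O := by
    intro z hz
    rw [segment_eq_image'] at hz
    obtain ⟨t, ht, rfl⟩ := hz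
    rw [mem_iInter]
    intro k hk
    exact hfree t ht.1 ht.2 ⟨k, k.2, hk⟩
  have hcpt : IsCompact (segment ℝ y y') := by
    rw [segment_eq_image']
    exact isCompact_Icc.image (by fun_prop)
  obtain ⟨δ, hδ, hth⟩ := hcpt.exists_thickening_subset_open hO hsub
  refine ⟨Metric.thickening δ (segment ℝ y y'), Metric.isOpen_thickening,
    (convex_segment y y').thickening δ, Metric.self_subset_thickening hδ _ (left_mem_segment ℝ y y'),
    Metric.self_subset_thickening hδ _ (right_mem_segment ℝ y y'), ?_⟩
  intro p hp hpos k hk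
  by_cases hki : k = i
  · subst hki
    have := hk φ hφ
    linarith
  · exact mem_iInter.mp (hth hp) ⟨k, hki⟩ hk

lemma tube_aux2 {H : Set (ℝ × ℝ)} (hH : c.IsHole H) {i : ι} {φ : Fn} {y y' : ℝ × ℝ}
    (hy : c.Rel i φ y) (hyH : y ∈ closure H)
    (hfree : ∀ s : ℝ, 0 ≤ s → s ≤ 1 → ¬ c.Tch i (y + s • (y' - y))) :
    ∃ N : Set (ℝ × ℝ), IsOpen N ∧ y' ∈ N ∧ ∀ p ∈ N, 0 < ev φ p → p ∈ H := by
  obtain ⟨N, h1, h2, h3, h4, h5⟩ := tube_aux hy.1 hfree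
  refine ⟨N, h1, h4, fun p hp hpos => ?_⟩
  obtain ⟨x, hxN, hxH⟩ := mem_closure_iff.mp hyH N h1 h3
  exact hH.absorb (N := N ∩ {p | 0 < ev φ p}) (h2.inter (convex_ev_gt φ))
    (fun p hp => h5 p hp.1 hp.2) ⟨hxN, hole_side hH hy hyH hxH⟩ hxH ⟨hp, hpos⟩

lemma line_tendsto (y w : ℝ × ℝ) : Tendsto (fun ε : ℝ => y + ε • w) (𝓝[>] 0) (𝓝 y) := by
  have : Continuous (fun ε : ℝ => y + ε • w) := by fun_prop
  have := this.tendsto 0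
  simp only [zero_smul, add_zero] at this
  exact this.mono_left nhdsWithin_le_nhds

lemma tube_enter {H : Set (ℝ × ℝ)} (hH : c.IsHole H) {i : ι} {φ : Fn} {y y' w : ℝ × ℝ}
    (hy : c.Rel i φ y) (hyH : y ∈ closure H) (hy' : ev φ y' = 0)
    (hfree : ∀ s : ℝ, 0 ≤ s → s ≤ 1 → ¬ c.Tch i (y + s • (y' - y))) (hw : 0 < ln φ w) :
    ∀ᶠ ε in 𝓝[>] (0:ℝ), y' + ε • w ∈ H := by
  obtain ⟨N, h1, h2, h3⟩ := tube_aux2 hH hy hyH hfree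
  filter_upwards [(line_tendsto y' w).eventually (h1.mem_nhds h2), self_mem_nhdsWithin] with ε a b
  have b : 0 < ε := b
  refine h3 _ a ?_
  rw [ev_add, ln_smul, hy']
  nlinarith [mul_pos b hw]

lemma mem_closure_of_enter {H : Set (ℝ × ℝ)} {y w : ℝ × ℝ}
    (h : ∀ᶠ ε in 𝓝[>] (0:ℝ), y + ε • w ∈ H) : y ∈ closure H :=
  mem_closure_of_tendsto (line_tendsto y w) h

lemma ln_normal {φ : Fn} (h : φ.a ^ 2 + φ.b ^ 2 = 1) : 0 < ln φ (φ.a, φ.b) := by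
  simp only [ln]; nlinarith

lemma tube {H : Set (ℝ × ℝ)} (hH : c.IsHole H) {i : ι} {φ : Fn} {y y' : ℝ × ℝ}
    (hy : c.Rel i φ y) (hyH : y ∈ closure H) (hy' : ev φ y' = 0)
    (hfree : ∀ s : ℝ, 0 ≤ s → s ≤ 1 → ¬ c.Tch i (y + s • (y' - y))) : y' ∈ closure H :=
  mem_closure_of_enter (tube_enter hH hy hyH hy' hfree (ln_normal (c.unit i φ hy.1)))

lemma convex_sector (v d d' : ℝ × ℝ) (e : ℝ) : Convex ℝ {p : ℝ × ℝ | ∃ a b : ℝ, 0 < a ∧ a < e ∧ 0 < b ∧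
    b < e ∧ p = v - a • d' + b • d} := by
  have h1 : Convex ℝ ((fun x : ℝ × ℝ => v + (-(x.1 • d') + x.2 • d)) '' (Ioo 0 e ×ˢ Ioo 0 e)) := by
    have h2 := ((convex_Ioo (0:ℝ) e).prod (convex_Ioo (0:ℝ) e)).linear_image
      (-(LinearMap.fst ℝ ℝ ℝ).smulRight d' + (LinearMap.snd ℝ ℝ ℝ).smulRight d)
    have h3 := h2.translate v
    rw [image_image] at h3
    exact h3
  convert h1 using 1
  ext p
  constructor
  · rintro ⟨a, b, h1, h2, h3, h4, rfl⟩
    exact ⟨(a, b), ⟨⟨h1, h2⟩, h3, h4⟩, by simp only; module⟩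
  · rintro ⟨⟨a, b⟩, ⟨⟨h1, h2⟩, h3, h4⟩, rfl⟩
    exact ⟨a, b, h1, h2, h3, h4, by simp only; module⟩

lemma sector_absorb {H : Set (ℝ × ℝ)} (hH : c.IsHole H) {v d d' : ℝ × ℝ} {e : ℝ}
    (hK : ∀ a b : ℝ, 0 < a → a < e → 0 < b → b < e → v - a • d' + b • d ∈ c.K) {a0 b0 : ℝ}
    (ha0 : 0 < a0) (ha1 : a0 < e) (hb0 : 0 < b0) (hb1 : b0 < e)
    (hin : v - a0 • d' + b0 • d ∈ H) :
    ∀ a b : ℝ, 0 < a → a < e → 0 < b → b < e → v - a • d' + b • d ∈ H := by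
  intro a b h1 h2 h3 h4
  refine hH.absorb (convex_sector v d d' e) ?_ ⟨a0, b0, ha0, ha1, hb0, hb1, rfl⟩ hin
    ⟨a, b, h1, h2, h3, h4, rfl⟩
  rintro p ⟨a, b, h1, h2, h3, h4, rfl⟩
  exact hK a b h1 h2 h3 h4

lemma ev_lt {e : ℝ} (he : 0 < e) : ∀ᶠ ε in 𝓝[>] (0 : ℝ), ε < e :=
  mem_of_superset (Ioo_mem_nhdsGT he) fun _ hx => hx.2

lemma sector_cl_right {H : Set (ℝ × ℝ)} {v d d' : ℝ × ℝ} {e : ℝ}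
    (h : ∀ a b : ℝ, 0 < a → a < e → 0 < b → b < e → v - a • d' + b • d ∈ H) {b : ℝ} (hb : 0 < b)
    (hb' : b < e) : v + b • d ∈ closure H := by
  refine mem_closure_of_enter (w := -d') ?_
  filter_upwards [ev_lt (hb.trans hb'), self_mem_nhdsWithin] with ε a1 a2
  convert h ε b a2 a1 hb hb' using 1; module

lemma sector_cl_left {H : Set (ℝ × ℝ)} {v d d' : ℝ × ℝ} {e : ℝ}
    (h : ∀ a b : ℝ, 0 < a → a < e → 0 < b → b < e → v - a • d' + b • d ∈ H) {a : ℝ} (ha : 0 < a)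
    (ha' : a < e) : v - a • d' ∈ closure H := by
  refine mem_closure_of_enter (w := d) ?_
  filter_upwards [ev_lt (ha.trans ha'), self_mem_nhdsWithin] with ε a1 a2
  exact h a ε ha ha' a2 a1

lemma sector_cl_mid {H : Set (ℝ × ℝ)} {v d d' : ℝ × ℝ} {e : ℝ} (he : 0 < e)
    (h : ∀ a b : ℝ, 0 < a → a < e → 0 < b → b < e → v - a • d' + b • d ∈ H) : v ∈ closure H := by
  refine mem_closure_of_enter (w := d - d') ?_
  filter_upwards [ev_lt he, self_mem_nhdsWithin] with ε a1 a2
  convert h ε ε a2 a1 a2 a1 using 1; module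

/-- adjacency goes backwards along links -/
lemma link_adj {σ : ℝ} (hσ : σ * σ = 1) {H : Set (ℝ × ℝ)} (hH : c.IsHole H) {i k : ι} {φ' φ : Fn}
    {v : ℝ × ℝ} (hl : Link c σ i φ' k φ v) (ha : c.Adj σ H k φ) :
    (∃ e : ℝ, 0 < e ∧ ∀ a b : ℝ, 0 < a → a < e → 0 < b → b < e →
      v - a • dir σ φ' + b • dir σ φ ∈ H) ∧ v ∈ closure H ∧ c.Adj σ H i φ' := by
  obtain ⟨y, hy, hyf, hyH⟩ := ha
  have hu := c.unit k φ hl.mem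
  have hu' := c.unit i φ' hl.rel.1
  have hy' := on_line hσ hu hy.2.1 hl.v0
  set s := tc σ φ y - tc σ φ v with hs
  rw [hy'] at hy
  have hspos := hl.toLinkL.rel_after hσ hy
  obtain ⟨e, he, hsec⟩ := hl.sector
  set b := min s e / 2 with hb
  have hm : 0 < min s e := lt_min hspos he
  have hbs : b < s := by have := min_le_left s e; linarith
  have hbe : b < e := by have := min_le_right s e; linarith
  have hb0 : 0 < b := by linarith
  have hent := tube_enter hH hy (y' := v + b • dir σ φ) (w := -dir σ φ') (hy' ▸ hyH)
    (by rw [ev_add, ln_smul, ln_dir_self, hl.v0]; simp) (by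
      intro t ht0 ht1
      have e1 : v + s • dir σ φ + t • (v + b • dir σ φ - (v + s • dir σ φ)) =
        v + (s - t * (s - b)) • dir σ φ := by module
      rw [e1]
      have hle : s - t * (s - b) ≤ s := by nlinarith
      have hpos : b ≤ s - t * (s - b) := by nlinarith
      have hrel : c.Rel k φ (v + (s - t * (s - b)) • dir σ φ) := by
        rcases eq_or_lt_of_le hle with h | h
        · rw [h]; exact hy
        · exact hl.toLinkL.rel_in hσ hy.mem (by linarith) h
      refine hyf _ hrel ?_
      rw [tc_add, tc_smul, tc_dir hσ hu]; linarith)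
    (by rw [ln_neg, ln_dir_anti]; simpa using hl.pos)
  obtain ⟨a0, ⟨h1, h2⟩, h3⟩ := ((hent.and (ev_lt he)).and self_mem_nhdsWithin).exists
  have hsecH := sector_absorb hH hsec (a0 := a0) (b0 := b) h3 h2 hb0 hbe (by
    convert h1 using 1; module)
  refine ⟨⟨e, he, hsecH⟩, sector_cl_mid he hsecH, ?_⟩
  obtain ⟨ε, hε, hr⟩ := hl.rel.near hσ
  have hm2 : 0 < min ε e := lt_min hε he
  set a := min ε e / 2 with hadef
  have h5 : a < ε := by have := min_le_left ε e; linarith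
  have h6 : a < e := by have := min_le_right ε e; linarith
  have h7 : 0 < a := by linarith
  refine ⟨v - a • dir σ φ', ?_, ?_, sector_cl_left hsecH h7 h6⟩
  · have := hr (-a) (by rw [abs_neg, abs_of_pos h7]; exact h5)
    convert this using 1; module
  · intro z hz hle
    refine hl.before z hz ?_
    rw [tc_sub, tc_smul, tc_dir hσ hu'] at hle
    linarith

/-- adjacency goes forward at a first touched point -/
lemma linkL_fwd {σ : ℝ} (hσ : σ * σ = 1) {H : Set (ℝ × ℝ)} (hH : c.IsHole H) {i k : ι} {φ' φ : Fn}
    {v y : ℝ × ℝ} (hl : LinkL c σ i φ' k φ v) (hy : c.Rel i φ' y) (hlt : tc σ φ' y < tc σ φ' v)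
    (hfree : ∀ z, c.Rel i φ' z → tc σ φ' y ≤ tc σ φ' z → tc σ φ' z < tc σ φ' v → ¬ c.Tch i z)
    (hyH : y ∈ closure H) : c.Adj σ H k φ := by
  have hu := c.unit k φ hl.mem
  have hu' := c.unit i φ' hl.rel.1
  have hy' := on_line hσ hu' hy.2.1 hl.rel.2.1
  set s := tc σ φ' v - tc σ φ' y with hs
  have hy' : y = v - s • dir σ φ' := by
    rw [hs]; nth_rewrite 1 [hy']; module
  have hspos : 0 < s := by linarith
  obtain ⟨e, he, hsec⟩ := hl.sector
  have hm : 0 < min s e := lt_min hspos he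
  set a := min s e / 2 with hb
  have has : a < s := by have := min_le_left s e; linarith
  have hae : a < e := by have := min_le_right s e; linarith
  have ha0 : 0 < a := by linarith
  have hent := tube_enter hH hy (y' := v - a • dir σ φ') (w := dir σ φ) hyH
    (by rw [ev_sub, ln_smul, ln_dir_self, hl.rel.2.1]; simp) (by
      intro t ht0 ht1
      have e1 : y + t • (v - a • dir σ φ' - y) = v - (s - t * (s - a)) • dir σ φ' := by
        rw [hy']; module
      have hle : s - t * (s - a) ≤ s := by nlinarith
      have hpos : a ≤ s - t * (s - a) := by nlinarith
      have e2 : y + t • (v - a • dir σ φ' - y) = y + (t * (s - a) / s) • (v - y) := by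
        have : v - y = s • dir σ φ' := by rw [hy']; module
        rw [this, smul_smul, div_mul_cancel₀ _ hspos.ne', e1, hy']; module
      have hr := hy.seg hl.rel (s := t * (s - a) / s) (div_nonneg (by nlinarith) hspos.le)
        (by rw [div_le_one hspos]; linarith)
      rw [← e2, e1] at hr
      rw [e1]
      refine hfree _ hr ?_ ?_ <;> rw [tc_sub, tc_smul, tc_dir hσ hu'] <;> linarith)
    hl.pos
  obtain ⟨b0, ⟨h1, h2⟩, h3⟩ := ((hent.and (ev_lt he)).and self_mem_nhdsWithin).exists
  have hsecH := sector_absorb hH hsec (a0 := a) (b0 := b0) ha0 hae h3 h2 h1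
  obtain ⟨b1, hb1, hb1'⟩ := hl.ext
  obtain ⟨e1, he1, hfr⟩ := hl.free
  have hm2 : 0 < min (min b1 e1) e := lt_min (lt_min hb1 he1) he
  set b := min (min b1 e1) e / 2 with hbdef
  have h5 : b < b1 := by
    have := min_le_left (min b1 e1) e; have := min_le_left b1 e1; linarith
  have h6 : b < e1 := by
    have := min_le_left (min b1 e1) e; have := min_le_right b1 e1; linarith
  have h7 : b < e := by have := min_le_right (min b1 e1) e; linarith
  have h8 : 0 < b := by linarith
  refine ⟨v + b • dir σ φ, hl.rel_in hσ hb1' h8 h5, ?_, sector_cl_right hsecH h8 h7⟩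
  intro z hz hle
  have hz' := on_line hσ hu hz.2.1 hl.v0
  rw [hz'] at hz ⊢
  apply hfr _ (hl.rel_after hσ hz)
  rw [tc_add, tc_smul, tc_dir hσ hu] at hle
  linarith

lemma rel_of_mid {i : ι} {φ : Fn} (hφ : φ ∈ c.cons i) {p q : ℝ × ℝ} (hp : p ∈ c.CU i)
    (hq : q ∈ c.CU i) (hp0 : ev φ p = 0) (hq0 : ev φ q = 0) (hne : p ≠ q) {s : ℝ} (h0 : 0 < s)
    (h1 : s < 1) : c.Rel i φ (p + s • (q - p)) := by
  have hu := c.unit i φ hφ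
  have key : ∀ σ : ℝ, σ * σ = 1 → 0 < tc σ φ q - tc σ φ p → c.Rel i φ (p + s • (q - p)) := by
    intro σ hσ hpos
    have e := on_line hσ hu hq0 hp0
    set D := tc σ φ q - tc σ φ p
    have e2 : q - p = D • dir σ φ := by nth_rewrite 1 [e]; module
    refine Cfg.Rel.of_dirs hφ ?_ hσ (e1 := (1 - s) * D) (e2 := s * D) (by nlinarith) (by positivity)
      ?_ ?_
    · rw [ev_add, ln_smul, ln_sub_pts, hp0, hq0]; simp
    · convert hq using 1
      rw [e2]; rw [e]; module
    · convert hp using 1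
      rw [e2]; module
  have hne2 : tc 1 φ q - tc 1 φ p ≠ 0 := by
    intro h
    have e := on_line (σ := 1) (by norm_num) hu hq0 hp0
    rw [h] at e
    exact hne (by simpa using e.symm)
  rcases lt_or_gt_of_ne hne2 with h | h
  · refine key (-1) (by norm_num) ?_
    simp only [tc] at *; linarith
  · exact key 1 (by norm_num) h

/-- every hole is adjacent to some state -/
lemma hole_adj [Nonempty ι] {H : Set (ℝ × ℝ)} (hH : c.IsHole H) :
    ∃ σ : ℝ, σ * σ = 1 ∧ ∃ k φ, c.Adj σ H k φ := by
  obtain ⟨p, hp⟩ := hH.nonempty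
  have hpK := hH.sub hp
  let g : ℝ × ℝ → ℝ := fun z => (z.1 - p.1) ^ 2 + (z.2 - p.2) ^ 2
  obtain ⟨k0⟩ := ‹Nonempty ι›
  obtain ⟨x0, hx0⟩ := c.ne k0
  have hx0 : x0 ∈ c.CU k0 := U_sub_CU c k0 hx0
  -- nearest point
  obtain ⟨y, ⟨k1, hk1⟩, hymin⟩ : ∃ y, (∃ k, y ∈ c.CU k) ∧ ∀ k, ∀ z ∈ c.CU k, g y ≤ g z := by
    set R := 1 + g x0 with hR
    have hg0 : 0 ≤ g x0 := by simp only [g]; positivity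
    set S : Set (ℝ × ℝ) := Metric.closedBall p R ∩ ⋃ k, c.CU k
    have hS : IsCompact S := (isCompact_closedBall p R).inter_right
      (isClosed_iUnion_of_finite fun k => closed_CU c k)
    have hx0S : x0 ∈ S := by
      refine ⟨?_, mem_iUnion.mpr ⟨k0, hx0⟩⟩
      rw [Metric.mem_closedBall, Prod.dist_eq, Real.dist_eq, Real.dist_eq]
      apply max_le
      · apply abs_le_of_sq_le_sq _ (by linarith)
        simp only [hR, g] at hg0 ⊢; nlinarith [sq_nonneg (x0.2 - p.2)]
      · apply abs_le_of_sq_le_sq _ (by linarith)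
        simp only [hR, g] at hg0 ⊢; nlinarith [sq_nonneg (x0.1 - p.1)]
    obtain ⟨y, hy, hmin⟩ := hS.exists_isMinOn ⟨x0, hx0S⟩ (f := g) (by fun_prop)
    refine ⟨y, mem_iUnion.mp hy.2, fun k z hz => ?_⟩
    by_cases hzb : z ∈ Metric.closedBall p R
    · exact hmin ⟨hzb, mem_iUnion.mpr ⟨k, hz⟩⟩
    · refine le_trans (hmin hx0S) ?_
      rw [Metric.mem_closedBall, Prod.dist_eq, Real.dist_eq, Real.dist_eq, not_le, lt_max_iff] at hzb
      have hRR : g x0 ≤ R ^ 2 := by rw [hR]; nlinarith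
      rcases hzb with h | h
      · have : R ^ 2 ≤ (z.1 - p.1)^2 := by
          rw [← sq_abs (z.1 - p.1)]; nlinarith [abs_nonneg (z.1 - p.1)]
        simp only [g] at *; nlinarith [sq_nonneg (z.2 - p.2)]
      · have : R ^ 2 ≤ (z.2 - p.2)^2 := by
          rw [← sq_abs (z.2 - p.2)]; nlinarith [abs_nonneg (z.2 - p.2)]
        simp only [g] at *; nlinarith [sq_nonneg (z.1 - p.1)]
  set e := p - y with he
  have hene : e ≠ 0 := by
    intro h
    rw [he, sub_eq_zero] at h
    exact hpK k1 (h ▸ hk1)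
  set w0 : ℝ × ℝ := (-e.2, e.1) with hw0
  have hw0ne : w0 ≠ 0 := by
    intro h
    have h1 := congrArg Prod.fst h
    have h2 := congrArg Prod.snd h
    simp [hw0] at h1 h2
    exact hene (Prod.ext h2 h1)
  have he2 : 0 < e.1^2+e.2^2 := by
    by_contra hn
    apply hene
    have a1 : e.1 = 0 := by nlinarith [sq_nonneg e.1, sq_nonneg e.2]
    have a2 : e.2 = 0 := by nlinarith [sq_nonneg e.1, sq_nonneg e.2]
    exact Prod.ext a1 a2
  have h11 : (1:ℝ) * 1 = 1 := by norm_num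
  have hpos : ∀ k, y ∈ c.CU k → ∀ z ∈ c.U k, 0 < 1 * cr w0 (z - y) := by
    intro k hk
    refine cr_strict h11 hw0ne ?_
    intro z hz
    by_contra hneg
    push Not at hneg
    set x := z - y with hx
    have hneg' : 0 < e.1 * x.1 + e.2 * x.2 := by
      simp only [cr, hw0] at hneg; linarith
    set n := x.1^2 + x.2^2 with hn
    have hn0 : 0 ≤ n := by positivity
    set t := min 1 ((e.1 * x.1 + e.2 * x.2) / (n + 1)) with ht
    have ht0 : 0 < t := lt_min one_pos (by positivity)
    have ht2 : t * (n + 1) ≤ e.1 * x.1 + e.2 * x.2 := by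
      have := min_le_right 1 ((e.1 * x.1 + e.2 * x.2) / (n + 1))
      rw [← ht, le_div_iff₀ (by linarith)] at this; exact this
    have hm := hymin k _ (U_sub_CU c k (mem_U_of_CU c hk hz ht0 (min_le_left _ _)))
    rw [← hx] at hm
    have hgy : g y = e.1^2+e.2^2 := by simp only [g, he, Prod.fst_sub, Prod.snd_sub]; ring
    have hgt : g (y + t • x) = e.1^2 + e.2^2 - 2 * t * (e.1 * x.1 + e.2 * x.2) + t^2 * n := by
      simp only [g, hn, he, Prod.fst_add, Prod.snd_add, Prod.smul_fst, Prod.smul_snd, smul_eq_mul,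
        Prod.fst_sub, Prod.snd_sub]; ring
    rw [hgy, hgt] at hm
    nlinarith [mul_pos ht0 hneg', mul_le_mul_of_nonneg_left ht2 ht0.le]
  obtain ⟨k, hk, ε, hε, hkε⟩ : ∃ k, y ∈ c.CU k ∧ ∃ ε : ℝ, 0 < ε ∧ y + ε • w0 ∈ c.CU k := by
    by_contra hno
    push Not at hno
    exact tip h11 y w0 ⟨k1, hk1⟩ fun k hk => ⟨hpos k hk, hno k hk⟩
  -- the edge
  obtain ⟨φ, hφ, hφm⟩ : ∃ φ ∈ c.cons k, 0 ≤ ev φ (y + (ε/2) • w0) := by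
    by_contra hno
    push Not at hno
    have := hpos k hk _ hno
    rw [add_sub_cancel_left, cr_smul, cr_self] at this
    simp at this
  have hu := c.unit k φ hφ
  have hφy : ev φ y = 0 ∧ ln φ w0 = 0 := by
    have a1 := hk φ hφ
    have a2 := hkε φ hφ
    rw [ev_add, ln_smul] at a2 hφm
    have : ε * ln φ w0 = 0 := by linarith
    rcases mul_eq_zero.mp this with h | h
    · linarith
    · exact ⟨by rw [h] at hφm; linarith, h⟩
  obtain ⟨hφ0, hφw⟩ := hφy
  have hevε : ev φ (y + ε • w0) = 0 := by rw [ev_add, ln_smul, hφ0, hφw]; simp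
  have hrel : ∀ s, 0 < s → s < ε → c.Rel k φ (y + s • w0) := by
    intro s h0 h1
    have := rel_of_mid hφ hk hkε hφ0 hevε (by
      intro h
      have : ε • w0 = 0 := by simpa using h.symm
      rcases smul_eq_zero.mp this with h | h
      · linarith
      · exact hw0ne h) (s := s / ε) (by positivity) (by rw [div_lt_one hε]; exact h1)
    rwa [add_sub_cancel_left, smul_smul, div_mul_cancel₀ _ hε.ne'] at this
  -- the functional is a multiple of the inner product with e
  have hφe : ∀ z, ev φ z * (e.1^2+e.2^2) = - ln φ e * cr w0 (z - y) := by
    intro z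
    have h1 : ev φ z = ln φ (z - y) := by rw [ln_sub_pts, hφ0]; ring
    rw [h1]
    simp only [ln, cr, hw0] at hφw ⊢
    linear_combination ((z-y).2 * e.1 - (z-y).1 * e.2) * hφw
  have hle : 0 < ln φ e := by
    obtain ⟨z, hz⟩ := c.ne k
    have h1 := hφe z
    have h2 := hz φ hφ
    have h3 := hpos k hk z hz
    rw [one_mul] at h3
    by_contra h; push Not at h
    nlinarith [mul_pos (neg_pos.mpr h2) he2, mul_nonneg (neg_nonneg.mpr h) h3.le]
  -- untouched near y
  have hunt : ∀ᶠ s in 𝓝[>] (0:ℝ), s < ε → ¬ c.Tch k (y + s • w0) := by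
    have : ∀ᶠ s in 𝓝[>] (0:ℝ), ∀ k', y ∉ c.CU k' → y + s • w0 ∉ c.CU k' := by
      rw [Filter.eventually_all]
      intro k'
      by_cases hk' : y ∈ c.CU k'
      · exact Eventually.of_forall fun s h => absurd hk' h
      · filter_upwards [(line_tendsto y w0).eventually (avoid hk')] with s h _ using h
    filter_upwards [this, self_mem_nhdsWithin] with s hs h0 hsε
    rintro ⟨k', hkk, hk'⟩
    by_cases hy' : y ∈ c.CU k'
    · obtain ⟨z, hz⟩ := c.ne k'
      have h1 := (hrel s h0 hsε).side hkk.symm hk' hz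
      have h2 := hpos k' hy' z hz
      rw [one_mul] at h2
      have h3 := hφe z
      nlinarith [mul_pos h1 he2, mul_pos hle h2]
    · exact hs k' hy' hk'
  have hcl : ∀ᶠ s in 𝓝[>] (0:ℝ), y + s • w0 ∈ closure H := by
    set O : Set (ℝ × ℝ) := ⋂ k : {k // y ∉ c.CU k}, (c.CU k)ᶜ
    have hO : IsOpen O := isOpen_iInter_of_finite fun k => (closed_CU c k).isOpen_compl
    have hsub : segment ℝ p y ⊆ O := by
      intro z hz
      rw [segment_eq_image'] at hz
      obtain ⟨t, ht, rfl⟩ := hz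
      rw [mem_iInter]
      intro k' hk'
      rcases eq_or_lt_of_le ht.2 with h | h
      · subst h; apply k'.2; simpa using hk'
      · have h1 := hymin k' _ hk'
        have hgy : g y = e.1^2+e.2^2 := by simp only [g, he, Prod.fst_sub, Prod.snd_sub]; ring
        have hgt : g (p + t • (y - p)) = t^2 * (e.1^2 + e.2^2) := by
          simp only [g, he, Prod.fst_add, Prod.snd_add, Prod.smul_fst, Prod.smul_snd, smul_eq_mul,
            Prod.fst_sub, Prod.snd_sub]; ring
        rw [hgy, hgt] at h1
        have : t ^ 2 < 1 := by have := ht.1; nlinarith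
        nlinarith
    have hcpt : IsCompact (segment ℝ p y) := by
      rw [segment_eq_image']
      exact isCompact_Icc.image (by fun_prop)
    obtain ⟨δ, hδ, hth⟩ := hcpt.exists_thickening_subset_open hO hsub
    set T := Metric.thickening δ (segment ℝ p y)
    have hT : IsOpen T := Metric.isOpen_thickening
    have hpT : p ∈ T := Metric.self_subset_thickening hδ _ (left_mem_segment ℝ p y)
    have hyT : y ∈ T := Metric.self_subset_thickening hδ _ (right_mem_segment ℝ p y)
    have hevp : 0 < ev φ p := by
      have : ev φ p = ln φ e := by rw [he, ln_sub_pts, hφ0]; ring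
      rw [this]; exact hle
    have hN : T ∩ {q | 0 < ev φ q} ⊆ H := by
      refine hH.absorb (((convex_segment p y).thickening δ).inter (convex_ev_gt φ)) ?_ ⟨hpT, hevp⟩ hp
      rintro q ⟨hq1, hq2⟩ k' hk'
      by_cases hy' : y ∈ c.CU k'
      · have h1 : 0 ≤ 1 * cr w0 (q - y) := by
          rw [← ev_crf]
          exact CU_nonneg (fun z hz => by rw [ev_crf]; exact (hpos k' hy' z hz).le) hk'
        rw [one_mul] at h1
        have h3 := hφe q
        have hq2 : 0 < ev φ q := hq2
        nlinarith [mul_pos hq2 he2, mul_nonneg hle.le h1]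
      · exact mem_iInter.mp (hth hq1) ⟨k', hy'⟩ hk'
    filter_upwards [(line_tendsto y w0).eventually (hT.mem_nhds hyT)] with s hs
    refine mem_closure_of_enter (w := e) ?_
    filter_upwards [(line_tendsto (y + s • w0) e).eventually (hT.mem_nhds hs), self_mem_nhdsWithin]
      with t ht1 ht2
    have ht2 : 0 < t := ht2
    refine hN ⟨ht1, ?_⟩
    show 0 < ev φ _
    rw [ev_add, ev_add, ln_smul, ln_smul, hφ0, hφw]
    nlinarith [mul_pos ht2 hle]
  obtain ⟨s, ⟨⟨h1, h2⟩, h3⟩, h4⟩ := (((hunt.and hcl).and (ev_lt hε)).and self_mem_nhdsWithin).exists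
  have hyr := hrel s h4 h3
  have hyu := h1 h3
  set y' := y + s • w0
  obtain ⟨q1, hq1, hq1t⟩ := edge_touched hyr
  have hne2 : tc 1 φ q1 - tc 1 φ y' ≠ 0 := by
    intro h
    have e := on_line h11 hu hq1.2.1 hyr.2.1
    rw [h] at e
    simp at e
    rw [e] at hq1t
    exact hyu hq1t
  obtain ⟨σ, hσ, hlt⟩ : ∃ σ : ℝ, σ * σ = 1 ∧ tc σ φ y' < tc σ φ q1 := by
    rcases lt_or_gt_of_ne hne2 with h | h
    · refine ⟨-1, by norm_num, ?_⟩
      simp only [tc] at *; linarith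
    · exact ⟨1, h11, by linarith⟩
  obtain ⟨q, hq, hqt, hyq, hfree⟩ := first_touch hσ hyr hq1 hyu hq1t hlt
  obtain ⟨k2, φ2, hl⟩ := step hσ hq hqt hyr hyq hfree
  exact ⟨σ, hσ, k2, φ2, linkL_fwd hσ hH hl hyr hyq hfree h2⟩

end Cake

namespace Cake

open Set Filter Topology

variable {ι : Type} [Fintype ι] {c : Cfg ι}

variable (c)
/-- a direction not parallel to any edge -/
def Cfg.Gen (u : ℝ × ℝ) : Prop := ∀ i, ∀ φ ∈ c.cons i, ln φ u ≠ 0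

/-- `v` is the strict extreme point of the set `k` in the direction `τ X` -/
def Cfg.Extr (u : ℝ × ℝ) (k : ι) (τ : ℝ) (v : ℝ × ℝ) : Prop :=
  v ∈ c.CU k ∧ ∀ z ∈ c.CU k, z ≠ v → 0 < τ * cr u (z - v)

def Cfg.Lab (u : ℝ × ℝ) (H : Set (ℝ × ℝ)) (k : ι) (τ : ℝ) : Prop :=
  ∃ v w, c.Extr u k τ v ∧ cr u w = 0 ∧ w ≠ 0 ∧ (∀ᶠ ε in 𝓝[>] (0 : ℝ), v + ε • w ∈ H) ∧
    ∀ᶠ ε in 𝓝[>] (0 : ℝ), v + ε • (-w) ∉ c.K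
variable {c}

lemma decomp (σ : ℝ) (φ' φ : Fn) (w : ℝ × ℝ) :
    ln φ' (dir σ φ) • w = (-ln φ w) • dir σ φ' + (ln φ' w) • dir σ φ := by
  ext <;> simp only [ln, dir, Prod.smul_fst, Prod.smul_snd, Prod.fst_add, Prod.snd_add, smul_eq_mul]
    <;> ring

lemma decomp' {σ : ℝ} {φ' φ : Fn} (h : 0 < ln φ' (dir σ φ)) (w : ℝ × ℝ) :
    w = (-ln φ w / ln φ' (dir σ φ)) • dir σ φ' + (ln φ' w / ln φ' (dir σ φ)) • dir σ φ := by
  have := decomp σ φ' φ w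
  have h2 : w = (ln φ' (dir σ φ))⁻¹ • (ln φ' (dir σ φ) • w) := by
    rw [smul_smul, inv_mul_cancel₀ h.ne', one_smul]
  rw [this] at h2
  rw [smul_add, smul_smul, smul_smul] at h2
  rw [div_eq_inv_mul, div_eq_inv_mul]
  exact h2

lemma scaled_ev {r : ℝ} (hr : 0 < r) {P : ℝ → Prop} (h : ∀ᶠ ε in 𝓝[>] (0 : ℝ), P ε) :
    ∀ᶠ ε in 𝓝[>] (0 : ℝ), P (r * ε) := by
  have ht : Tendsto (fun ε : ℝ => r * ε) (𝓝[>] 0) (𝓝[>] 0) := by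
    apply tendsto_nhdsWithin_of_tendsto_nhds_of_eventually_within
    · have : Continuous fun ε : ℝ => r * ε := by fun_prop
      have := this.tendsto 0
      rw [mul_zero] at this
      exact this.mono_left nhdsWithin_le_nhds
    · filter_upwards [self_mem_nhdsWithin] with ε hε
      exact mul_pos hr hε
  exact ht.eventually h

lemma par_u {u w w' : ℝ × ℝ} (hu : u ≠ 0) (hw : cr u w = 0) (hw' : cr u w' = 0) (h0 : w ≠ 0) :
    ∃ r : ℝ, w' = r • w := by
  have hw2 : w.1 ^ 2 + w.2 ^ 2 ≠ 0 := by
    intro h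
    apply h0
    ext <;> simp <;> nlinarith [sq_nonneg w.1, sq_nonneg w.2]
  have key : w.1 * w'.2 - w.2 * w'.1 = 0 := by
    simp only [cr] at hw hw'
    have a1 : u.1 * (w.1 * w'.2 - w.2 * w'.1) = 0 := by linear_combination w.1 * hw' - w'.1 * hw
    have a2 : u.2 * (w.1 * w'.2 - w.2 * w'.1) = 0 := by linear_combination w.2 * hw' - w'.2 * hw
    rcases mul_eq_zero.mp a1 with h | h
    · rcases mul_eq_zero.mp a2 with h' | h'
      · exact absurd (Prod.ext h h') hu
      · exact h'
    · exact h
  refine ⟨(w.1 * w'.1 + w.2 * w'.2) / (w.1 ^ 2 + w.2 ^ 2), ?_⟩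
  ext
  · simp only [Prod.smul_fst, smul_eq_mul]
    field_simp
    linear_combination (-w.2) * key
  · simp only [Prod.smul_snd, smul_eq_mul]
    field_simp
    linear_combination (w.1) * key

lemma Cfg.Extr.unique {u : ℝ × ℝ} {k : ι} {τ : ℝ} {v v' : ℝ × ℝ} (h : c.Extr u k τ v)
    (h' : c.Extr u k τ v') : v = v' := by
  by_contra hne
  have a := h.2 v' h'.1 (Ne.symm hne)
  have b := h'.2 v h.1 hne
  rw [cr_sub] at a b
  nlinarith

lemma lab_inj {u : ℝ × ℝ} (hu : u ≠ 0) {H H' : Set (ℝ × ℝ)} (hH : c.IsHole H) (hH' : c.IsHole H')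
    {k : ι} {τ : ℝ} (h : c.Lab u H k τ) (h' : c.Lab u H' k τ) : H = H' := by
  obtain ⟨v, w, h1, h2, h3, h4, h5⟩ := h
  obtain ⟨v', w', h1', h2', h3', h4', h5'⟩ := h'
  obtain rfl := h1.unique h1'
  obtain ⟨r, rfl⟩ := par_u hu h2 h2' h3
  rcases lt_trichotomy r 0 with hr | hr | hr
  · exfalso
    obtain ⟨ε, e1, e2⟩ := (h4'.and (scaled_ev (neg_pos.mpr hr) h5)).exists
    apply e2
    convert hH'.sub e1 using 1
    module
  · exact absurd (by simp [hr]) h3'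
  · obtain ⟨ε, e1, e2⟩ := (h4'.and (scaled_ev hr h4)).exists
    refine hole_eq hH hH' e2 ?_
    convert e1 using 1
    module

lemma same_sign {σ : ℝ} {u : ℝ × ℝ} {H : Set (ℝ × ℝ)} {i k : ι} {φ' φ : Fn} {v : ℝ × ℝ}
    (hl : Link c σ i φ' k φ v)
    (hs : ∃ e : ℝ, 0 < e ∧ ∀ a b : ℝ, 0 < a → a < e → 0 < b → b < e →
      v - a • dir σ φ' + b • dir σ φ ∈ H) {τ : ℝ} (ha : 0 < τ * cr u (dir σ φ'))
    (hb : 0 < τ * cr u (dir σ φ)) : c.Lab u H k τ := by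
  have hP := hl.pos
  set P := ln φ' (dir σ φ) with hPd
  have hwφ : ln φ' (-(τ * cr u (dir σ φ)) • dir σ φ' + (τ * cr u (dir σ φ')) • dir σ φ)
      = (τ * cr u (dir σ φ')) * P := by
    rw [ln_add, ln_smul, ln_smul, ln_dir_self]; ring
  refine ⟨v, -(τ * cr u (dir σ φ)) • dir σ φ' + (τ * cr u (dir σ φ')) • dir σ φ, ⟨hl.vk, ?_⟩, ?_,
    ?_, ?_, ?_⟩
  · intro z hz hne
    have h1 := hl.rel.side' hl.ne hl.vk hz
    have h2 := hz φ hl.mem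
    have e := decomp' hP (z - v)
    rw [ln_sub_pts, ln_sub_pts, hl.v0, hl.rel.2.1, ← hPd] at e
    have hα : 0 ≤ -(ev φ z - 0) / P := div_nonneg (by linarith) hP.le
    have hβ : 0 ≤ (ev φ' z - 0) / P := div_nonneg (by linarith) hP.le
    set α := -(ev φ z - 0) / P
    set β := (ev φ' z - 0) / P
    rw [e, cr_add, cr_smul, cr_smul]
    by_contra hcon
    push Not at hcon
    have a1 := mul_nonneg hα ha.le
    have a2 := mul_nonneg hβ hb.le
    have b1 : α * (τ * cr u (dir σ φ')) = 0 := by nlinarith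
    have b2 : β * (τ * cr u (dir σ φ)) = 0 := by nlinarith
    have c1 := (mul_eq_zero.mp b1).resolve_right ha.ne'
    have c2 := (mul_eq_zero.mp b2).resolve_right hb.ne'
    rw [c1, c2] at e
    apply hne
    rw [← sub_eq_zero, e]; simp
  · rw [cr_add, cr_smul, cr_smul]; ring
  · intro h0
    rw [h0] at hwφ
    have : ln φ' (0 : ℝ × ℝ) = 0 := by simp [ln]
    have := mul_pos ha hP
    linarith
  · obtain ⟨e, he, hs⟩ := hs
    filter_upwards [scaled_ev ha (ev_lt he), scaled_ev hb (ev_lt he), self_mem_nhdsWithin] with ε h1 h2 h3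
    have h3 : 0 < ε := h3
    convert hs _ _ (mul_pos hb h3) h2 (mul_pos ha h3) h1 using 1
    module
  · have : ln φ' (-(-(τ * cr u (dir σ φ)) • dir σ φ' + (τ * cr u (dir σ φ')) • dir σ φ)) < 0 := by
      rw [ln_neg, hwφ]; have := mul_pos ha hP; linarith
    filter_upwards [hl.rel.half this] with ε hε hK
    exact hK i (U_sub_CU c i hε)

lemma closure_ge {H : Set (ℝ × ℝ)} {φ : Fn} (h : ∀ z ∈ H, 0 < ev φ z) {z : ℝ × ℝ}
    (hz : z ∈ closure H) : 0 ≤ ev φ z := by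
  have : closure H ⊆ {z | 0 ≤ ev φ z} :=
    closure_minimal (fun z hz => (h z hz).le) (isClosed_le continuous_const (ev_continuous φ))
  exact this hz

lemma Cfg.Adj.side {σ : ℝ} {H : Set (ℝ × ℝ)} (hH : c.IsHole H) {k : ι} {φ : Fn}
    (h : c.Adj σ H k φ) : ∀ z ∈ H, 0 < ev φ z := by
  obtain ⟨y, h1, _, h3⟩ := h
  exact fun z hz => hole_side hH h1 h3 hz

/-- alternating signs: `v` is a strict extreme point of the closure of the hole -/
lemma alt_extr {σ : ℝ} {u : ℝ × ℝ} {H : Set (ℝ × ℝ)} {i k : ι} {φ' φ : Fn} {v : ℝ × ℝ}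
    (hl : Link c σ i φ' k φ v) (h1 : ∀ z ∈ H, 0 < ev φ' z) (h2 : ∀ z ∈ H, 0 < ev φ z)
    {τ : ℝ} (ha : τ * cr u (dir σ φ') < 0)
    (hb : 0 < τ * cr u (dir σ φ)) {z : ℝ × ℝ} (hz : z ∈ closure H) (hne : z ≠ v) :
    0 < τ * cr u (z - v) := by
  have hP := hl.pos
  set P := ln φ' (dir σ φ) with hPd
  have h1 := closure_ge h1 hz
  have h2 := closure_ge h2 hz
  have e := decomp' hP (z - v)
  rw [ln_sub_pts, ln_sub_pts, hl.v0, hl.rel.2.1, ← hPd] at e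
  have hα : 0 ≤ (ev φ z - 0) / P := div_nonneg (by linarith) hP.le
  have hβ : 0 ≤ (ev φ' z - 0) / P := div_nonneg (by linarith) hP.le
  rw [neg_div] at e
  set α := (ev φ z - 0) / P
  set β := (ev φ' z - 0) / P
  rw [e, cr_add, cr_smul, cr_smul]
  by_contra hcon
  push Not at hcon
  have a1 := mul_nonneg hα (neg_pos.mpr ha).le
  have a2 := mul_nonneg hβ hb.le
  have b1 : α * (-(τ * cr u (dir σ φ'))) = 0 := by nlinarith
  have b2 : β * (τ * cr u (dir σ φ)) = 0 := by nlinarith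
  have c1 := (mul_eq_zero.mp b1).resolve_right (neg_pos.mpr ha).ne'
  have c2 := (mul_eq_zero.mp b2).resolve_right hb.ne'
  rw [c1, c2] at e
  apply hne
  rw [← sub_eq_zero, e]; simp

lemma gen_cr {u : ℝ × ℝ} (hu : c.Gen u) {σ : ℝ} (hσ : σ * σ = 1) {i : ι} {φ : Fn}
    (hφ : φ ∈ c.cons i) : cr u (dir σ φ) ≠ 0 := by
  rw [cr_dir]
  intro h
  rcases mul_eq_zero.mp h with h | h
  · rw [h] at hσ; norm_num at hσ
  · exact hu i φ hφ h

lemma exists_lab [Nonempty ι] {u : ℝ × ℝ} (hu : c.Gen u) {H : Set (ℝ × ℝ)} (hH : c.IsHole H) :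
    ∃ k τ, (τ = 1 ∨ τ = -1) ∧ c.Lab u H k τ := by
  obtain ⟨σ, hσ, k0, φ0, A0⟩ := hole_adj hH
  obtain ⟨k1, φ1, v0, L0⟩ := pred_link hσ A0.state
  obtain ⟨S0, C0, A1⟩ := link_adj hσ hH L0 A0
  obtain ⟨k2, φ2, v1, L1⟩ := pred_link hσ A1.state
  obtain ⟨S1, C1, A2⟩ := link_adj hσ hH L1 A1
  obtain ⟨k3, φ3, v2, L2⟩ := pred_link hσ A2.state
  obtain ⟨S2, C2, A3⟩ := link_adj hσ hH L2 A2
  have x0 := gen_cr hu hσ L0.mem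
  have x1 := gen_cr hu hσ L1.mem
  have x2 := gen_cr hu hσ L2.mem
  have x3 := gen_cr hu hσ L2.rel.1
  have same : ∀ {i k : ι} {φ' φ : Fn} {v : ℝ × ℝ}, Link c σ i φ' k φ v →
    (∃ e : ℝ, 0 < e ∧ ∀ a b : ℝ, 0 < a → a < e → 0 < b → b < e →
      v - a • dir σ φ' + b • dir σ φ ∈ H) → 0 < cr u (dir σ φ') * cr u (dir σ φ) →
      ∃ k τ, (τ = 1 ∨ τ = -1) ∧ c.Lab u H k τ := by
    intro i k φ' φ v hl hs hpos
    rcases pos_and_pos_or_neg_and_neg_of_mul_pos hpos with ⟨h1, h2⟩ | ⟨h1, h2⟩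
    · exact ⟨k, 1, Or.inl rfl, same_sign hl hs (by linarith) (by linarith)⟩
    · exact ⟨k, -1, Or.inr rfl, same_sign hl hs (by linarith) (by linarith)⟩
  by_cases h0 : 0 < cr u (dir σ φ1) * cr u (dir σ φ0)
  · exact same L0 S0 h0
  by_cases h1 : 0 < cr u (dir σ φ2) * cr u (dir σ φ1)
  · exact same L1 S1 h1
  by_cases h2 : 0 < cr u (dir σ φ3) * cr u (dir σ φ2)
  · exact same L2 S2 h2
  exfalso
  have h0 := lt_of_le_of_ne (not_lt.mp h0) (mul_ne_zero x1 x0)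
  have h1 := lt_of_le_of_ne (not_lt.mp h1) (mul_ne_zero x2 x1)
  have h2 := lt_of_le_of_ne (not_lt.mp h2) (mul_ne_zero x3 x2)
  have heq : v2 = v0 := by
    by_contra hne
    have key : ∀ τ : ℝ, 0 < τ * cr u (dir σ φ0) → τ * cr u (dir σ φ1) < 0 →
        0 < τ * cr u (dir σ φ2) → τ * cr u (dir σ φ3) < 0 → False := by
      intro τ y0 y1 y2 y3
      have a := alt_extr L0 (A1.side hH) (A0.side hH) y1 y0 C2 hne
      have b := alt_extr L2 (A3.side hH) (A2.side hH) y3 y2 C0 (Ne.symm hne)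
      rw [cr_sub] at a b
      nlinarith
    rcases lt_or_gt_of_ne x0 with y0 | y0
    · have y1 : 0 < cr u (dir σ φ1) := by nlinarith
      have y2 : cr u (dir σ φ2) < 0 := by nlinarith
      have y3 : 0 < cr u (dir σ φ3) := by nlinarith
      exact key (-1) (by linarith) (by linarith) (by linarith) (by linarith)
    · have y1 : cr u (dir σ φ1) < 0 := by nlinarith
      have y2 : 0 < cr u (dir σ φ2) := by nlinarith
      have y3 : cr u (dir σ φ3) < 0 := by nlinarith
      exact key 1 (by linarith) (by linarith) (by linarith) (by linarith)
  have e0 := on_line hσ (c.unit _ _ L1.mem) L0.rel.2.1 L1.v0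
  have e1 := on_line hσ (c.unit _ _ L2.mem) L1.rel.2.1 L2.v0
  have p0 := L1.toLinkL.rel_after hσ (e0 ▸ L0.rel)
  have q : ln φ2 (v0 - v1) = (tc σ φ1 v0 - tc σ φ1 v1) * ln φ2 (dir σ φ1) := by
    nth_rewrite 1 [e0]
    rw [add_sub_cancel_left, ln_smul]
  rw [ln_sub_pts, L1.rel.2.1, ← heq, L2.v0] at q
  have := mul_pos p0 L1.pos
  rw [← heq] at this
  linarith

/-- holes contain no ray in the generic direction -/
lemma no_ray [Nonempty ι] {u : ℝ × ℝ} (hu : c.Gen u) {H : Set (ℝ × ℝ)} (hH : c.IsHole H)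
    {p : ℝ × ℝ} (hp : ∀ t : ℝ, 0 ≤ t → p + t • u ∈ H) : False := by
  obtain ⟨σ, hσ, k0, φ0, A0⟩ := hole_adj hH
  let S := {x : ι × Fn // c.Adj σ H x.1 x.2}
  have hfin : Finite S := by
    have : ({x : ι × Fn | c.Adj σ H x.1 x.2}).Finite := by
      apply Set.Finite.subset (s := ⋃ i : ι, (fun φ => (i, φ)) '' (c.cons i : Set Fn))
      · exact Set.finite_iUnion fun i => (Finset.finite_toSet _).image _
      · rintro ⟨i, χ⟩ hx
        exact mem_iUnion.mpr ⟨i, χ, hx.state.1, rfl⟩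
    exact this.to_subtype
  have hne : Nonempty S := ⟨⟨(k0, φ0), A0⟩⟩
  have hstep : ∀ s : S, ∃ (s' : S) (v : ℝ × ℝ), Link c σ s'.1.1 s'.1.2 s.1.1 s.1.2 v := by
    rintro ⟨⟨k, φ⟩, A⟩
    obtain ⟨i, φ', v, L⟩ := pred_link hσ A.state
    exact ⟨⟨(i, φ'), (link_adj hσ hH L A).2.2⟩, v, L⟩
  choose pr v hL using hstep
  obtain ⟨s, hs⟩ := Finite.exists_min (fun s : S => σ * cr u (v s))
  have L0 := hL s
  have L1 := hL (pr s)
  have hmem : (pr s).1.2 ∈ c.cons (pr s).1.1 := L1.mem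
  have hside := (pr s).2.side hH
  have hln : 0 < ln (pr s).1.2 u := by
    refine lt_of_le_of_ne ?_ (Ne.symm (hu _ _ hmem))
    by_contra hcon
    push Not at hcon
    set E := ev (pr s).1.2 p
    have a0 : 0 < E := by have := hside _ (hp 0 le_rfl); simpa using this
    have := hside _ (hp (E / -ln (pr s).1.2 u) (div_nonneg a0.le (by linarith)))
    rw [ev_add, ln_smul] at this
    have h3 : E / -ln (pr s).1.2 u * ln (pr s).1.2 u = -E := by have := hcon.ne; field_simp
    rw [h3] at this
    change 0 < E + -E at this
    linarith
  have e0 := on_line hσ (c.unit _ _ hmem) L0.rel.2.1 L1.v0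
  have p0 := L1.toLinkL.rel_after hσ (e0 ▸ L0.rel)
  have hmin := hs (pr s)
  have q : cr u (v s) = cr u (v (pr s)) + (tc σ (pr s).1.2 (v s) - tc σ (pr s).1.2 (v (pr s))) *
      (σ * ln (pr s).1.2 u) := by
    nth_rewrite 1 [e0]
    rw [cr_add, cr_smul, cr_dir]
  rw [q] at hmin
  have := mul_pos p0 hln
  have h4 : σ * (cr u (v (pr s)) + (tc σ (pr s).1.2 (v s) - tc σ (pr s).1.2 (v (pr s))) *
      (σ * ln (pr s).1.2 u)) = σ * cr u (v (pr s)) + (σ * σ) * ((tc σ (pr s).1.2 (v s) - tc σ (pr s).1.2 (v (pr s))) * ln (pr s).1.2 u) := by ring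
  rw [h4, hσ] at hmin
  linarith

end Cake

namespace Cake

open Set Filter Topology

variable {ι : Type} [Fintype ι] {c : Cfg ι}

lemma exists_gen (c : Cfg ι) : ∃ u : ℝ × ℝ, u ≠ 0 ∧ c.Gen u := by
  classical
  obtain ⟨t, ht⟩ := Infinite.exists_notMem_finset
    ((Finset.univ.biUnion fun i => c.cons i).image fun φ : Fn => -φ.a / φ.b)
  refine ⟨(1, t), by simp, ?_⟩
  intro i φ hφ h
  have hu := c.unit i φ hφ
  simp only [ln, mul_one] at h
  apply ht
  rw [Finset.mem_image]
  refine ⟨φ, by simpa using ⟨i, hφ⟩, ?_⟩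
  have hb : φ.b ≠ 0 := by
    intro hb
    rw [hb] at h hu
    have : φ.a = 0 := by linarith
    rw [this] at hu; norm_num at hu
  field_simp
  linarith

lemma Cfg.Gen.neg {u : ℝ × ℝ} (h : c.Gen u) : c.Gen (-u) := by
  intro i φ hφ
  rw [ln_neg]
  exact neg_ne_zero.mpr (h i φ hφ)

lemma exists_up [Nonempty ι] {u : ℝ × ℝ} (hu : c.Gen u) : ∃ a, ∀ φ ∈ c.cons a, ln φ u < 0 := by
  by_contra hcon
  push Not at hcon
  have hev : ∀ᶠ t : ℝ in atTop, ∀ i, t • u ∉ c.CU i := by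
    rw [Filter.eventually_all]
    intro i
    obtain ⟨φ, hφ, h0⟩ := hcon i
    have h0 := lt_of_le_of_ne h0 (Ne.symm (hu i φ hφ))
    filter_upwards [eventually_gt_atTop (-φ.c / ln φ u)] with t ht hmem
    have h1 := hmem φ hφ
    have h2 : ev φ (t • u) = t * ln φ u + φ.c := by simp [ev, ln]; ring
    rw [h2] at h1
    rw [div_lt_iff₀ h0] at ht
    linarith
  obtain ⟨T, hT⟩ := eventually_atTop.mp hev
  have hK : ∀ t : ℝ, 0 ≤ t → T • u + t • u ∈ c.K := by
    intro t ht i hi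
    apply hT (T + t) (by linarith) i
    convert hi using 1; module
  have h0 : T • u ∈ c.K := by simpa using hK 0 le_rfl
  obtain ⟨H, hH, hp⟩ := hole_of h0
  refine no_ray hu hH (p := T • u) ?_
  intro t ht
  refine hH.absorb (N := {p | ∃ t : ℝ, 0 ≤ t ∧ p = T • u + t • u}) ?_ ?_ (x := T • u)
    ⟨0, le_rfl, by simp⟩ hp ⟨t, ht, rfl⟩
  · rintro _ ⟨t1, h1, rfl⟩ _ ⟨t2, h2, rfl⟩ α β hα hβ hab
    refine ⟨α * t1 + β * t2, by positivity, ?_⟩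
    have : β = 1 - α := by linarith
    subst this
    module
  · rintro _ ⟨t1, h1, rfl⟩
    exact hK t1 h1

lemma CU_U_disj {a k : ι} (h : a ≠ k) {w : ℝ × ℝ} (h1 : w ∈ c.CU a) (h2 : w ∈ c.U k) : False := by
  obtain ⟨z, hz⟩ := c.ne a
  obtain ⟨ε, ⟨e1, e2⟩, e3⟩ := (((U_move h2 (z - w)).and ev01).and self_mem_nhdsWithin).exists
  exact disjU h (mem_U_of_CU c h1 hz e3 e2) e1

lemma no_extr_up {u : ℝ × ℝ} (hu : u ≠ 0) {a : ι} (ha : ∀ φ ∈ c.cons a, ln φ u < 0) {τ : ℝ}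
    {v : ℝ × ℝ} (h : c.Extr u a τ v) : False := by
  have hm : v + u ∈ c.CU a := by
    intro φ hφ
    rw [ev_add]
    have := h.1 φ hφ
    have := ha φ hφ
    linarith
  have := h.2 _ hm (by simpa using hu)
  rw [add_sub_cancel_left, cr_self] at this
  simp at this

lemma no_extr_down {u : ℝ × ℝ} (hu : u ≠ 0) {a : ι} (ha : ∀ φ ∈ c.cons a, 0 < ln φ u) {τ : ℝ}
    {v : ℝ × ℝ} (h : c.Extr u a τ v) : False := by
  have hm : v - u ∈ c.CU a := by
    intro φ hφ
    rw [ev_sub]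
    have := h.1 φ hφ
    have := ha φ hφ
    linarith
  have := h.2 _ hm (by simpa using hu)
  rw [sub_sub_cancel_left, cr_neg, cr_self] at this
  simp at this

lemma env (F : Finset Fn) (hF : F.Nonempty) (s r : Fn → ℝ) :
    ∃ φ ∈ F, ∃ x0 : ℝ, ∀ x, x0 ≤ x → ∀ χ ∈ F, x * s φ + r φ ≤ x * s χ + r χ := by
  obtain ⟨φ, hφ, hmin⟩ := Finset.exists_min_image F (fun χ => toLex (s χ, r χ)) hF
  refine ⟨φ, hφ, ?_⟩
  have : ∀ᶠ x in atTop, ∀ χ ∈ F, x * s φ + r φ ≤ x * s χ + r χ := by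
    rw [Filter.eventually_all_finset]
    intro χ hχ
    have h := hmin χ hχ
    rw [Prod.Lex.toLex_le_toLex] at h
    rcases h with h | ⟨h, h'⟩
    · simp only at h
      filter_upwards [eventually_ge_atTop ((r φ - r χ) / (s χ - s φ))] with x hx
      rw [div_le_iff₀ (by linarith)] at hx
      nlinarith
    · simp only at h h'
      filter_upwards with x
      rw [h]; linarith
  exact eventually_atTop.mp this

lemma far_right {u : ℝ × ℝ} (hu : u ≠ 0) {a b : ι} (hab : a ≠ b)
    (ha : ∀ φ ∈ c.cons a, 0 < ln φ u) {M : ℝ}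
    (hM : ∀ k, k ≠ a → k ≠ b → ∀ z ∈ c.CU k, cr u z ≤ M) (C : ℝ) :
    ∃ z, z ∈ c.CU a ∧ z ∈ c.CU b ∧ C ≤ cr u z := by
  by_contra hcon
  push Not at hcon
  have hne : (c.cons a).Nonempty := by
    by_contra h
    rw [Finset.not_nonempty_iff_eq_empty] at h
    obtain ⟨z, hz⟩ := c.ne b
    exact c.disj a b hab z (by simp [h]) hz
  have hn : u.1 ^ 2 + u.2 ^ 2 ≠ 0 := by
    intro h
    apply hu
    ext <;> simp <;> nlinarith [sq_nonneg u.1, sq_nonneg u.2]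
  set e : ℝ × ℝ := (-u.2 / (u.1 ^ 2 + u.2 ^ 2), u.1 / (u.1 ^ 2 + u.2 ^ 2)) with he
  have hce : cr u e = 1 := by
    simp only [cr, he]; field_simp; ring
  set s : Fn → ℝ := fun χ => -ln χ e / ln χ u with hs
  set r : Fn → ℝ := fun χ => -χ.c / ln χ u with hr
  obtain ⟨φ, hφ, x0, hx0⟩ := env (c.cons a) hne s r
  have hu1 := c.unit a φ hφ
  have hpos := ha φ hφ
  set A : ℝ → ℝ × ℝ := fun x => x • e + (x * s φ + r φ) • u with hA
  have hXA : ∀ x, cr u (A x) = x := by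
    intro x; simp only [hA]; rw [cr_add, cr_smul, cr_smul, hce, cr_self]; ring
  have hevA : ∀ x χ, χ ∈ c.cons a → ev χ (A x) = ((x * s φ + r φ) - (x * s χ + r χ)) * ln χ u := by
    intro x χ hχ
    have h1 := (ha χ hχ).ne'
    have h2 : ev χ (A x) = x * ln χ e + (x * s φ + r φ) * ln χ u + χ.c := by
      simp only [hA, ev, ln, Prod.fst_add, Prod.snd_add, Prod.smul_fst, Prod.smul_snd, smul_eq_mul]
      ring
    have h3 : s χ * ln χ u = -ln χ e := by simp only [hs]; field_simp
    have h4 : r χ * ln χ u = -χ.c := by simp only [hr]; field_simp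
    rw [h2]; linear_combination x * h3 + h4
  have hAC : ∀ x, x0 ≤ x → A x ∈ c.CU a := by
    intro x hx χ hχ
    rw [hevA x χ hχ]
    have := hx0 x hx χ hχ
    have := ha χ hχ
    nlinarith
  have hA0 : ∀ x, ev φ (A x) = 0 := by
    intro x; rw [hevA x φ hφ]; ring
  have hσ : (-1 : ℝ) * -1 = 1 := by norm_num
  set y := max x0 (max C M) + 1 with hy
  have hy1 : x0 < y := by have := le_max_left x0 (max C M); linarith
  have hy2 : C < y := by have := le_max_right x0 (max C M); have := le_max_left C M; linarith
  have hy3 : M < y := by have := le_max_right x0 (max C M); have := le_max_right C M; linarith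
  have hrel : c.Rel a φ (A y) := by
    have hne : A x0 ≠ A (2 * y - x0) := by
      intro h
      have := congrArg (cr u) h
      rw [hXA, hXA] at this
      linarith
    have := rel_of_mid hφ (hAC x0 le_rfl) (hAC (2 * y - x0) (by linarith)) (hA0 _) (hA0 _) hne
      (s := 1/2) (by norm_num) (by norm_num)
    convert this using 1
    simp only [hA]; module
  have hst : c.State (-1) a φ := by
    refine ⟨hφ, A y, hrel, ?_⟩
    rintro z hz ht ⟨k, hk, hkz⟩
    have e1 := on_line hσ hu1 hz.2.1 (hA0 y)
    have e2 : cr u z = y + (tc (-1) φ z - tc (-1) φ (A y)) * (-1 * ln φ u) := by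
      nth_rewrite 1 [e1]
      rw [cr_add, cr_smul, cr_dir, hXA]
    have e3 : y ≤ cr u z := by rw [e2]; nlinarith
    by_cases hkb : k = b
    · subst hkb
      have := hcon z hz.mem hkz
      linarith
    · have := hM k hk hkb z hkz
      linarith
  obtain ⟨i, φ', v, L⟩ := pred_link hσ hst
  have e1 := on_line hσ hu1 (hA0 (max x0 (cr u v + 1))) L.v0
  have e2 := L.toLinkL.after (e1 ▸ hAC _ (le_max_left _ _))
  have e3 := congrArg (cr u) e1
  rw [hXA, cr_add, cr_smul, cr_dir] at e3
  have := le_max_right x0 (cr u v + 1)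
  nlinarith

lemma fifth {u : ℝ × ℝ} (hu : u ≠ 0) {a b : ι} (hab : a ≠ b)
    (ha : ∀ φ ∈ c.cons a, 0 < ln φ u) (hb : ∀ φ ∈ c.cons b, ln φ u < 0) {k : ι} (hka : k ≠ a)
    (hkb : k ≠ b) : ∃ k, k ≠ a ∧ k ≠ b ∧ ∃ τ : ℝ, (τ = 1 ∨ τ = -1) ∧ ∀ v, ¬ c.Extr u k τ v := by
  by_contra hcon
  push Not at hcon
  have hbd : ∀ τ : ℝ, (τ = 1 ∨ τ = -1) → ∃ M : ℝ, ∀ k, k ≠ a → k ≠ b → ∀ z ∈ c.CU k,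
      M ≤ τ * cr u z := by
    intro τ hτ
    have : ∀ k, ∃ m : ℝ, k ≠ a → k ≠ b → ∀ z ∈ c.CU k, m ≤ τ * cr u z := by
      intro k
      by_cases h : k ≠ a ∧ k ≠ b
      · obtain ⟨v, hv⟩ := hcon k h.1 h.2 τ hτ
        refine ⟨τ * cr u v, fun _ _ z hz => ?_⟩
        by_cases hzv : z = v
        · rw [hzv]
        · have := hv.2 z hz hzv
          rw [cr_sub] at this
          linarith
      · exact ⟨0, fun h1 h2 => absurd ⟨h1, h2⟩ h⟩
    choose m hm using this
    obtain ⟨M, hM⟩ := (Set.finite_range m).bddBelow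
    refine ⟨M, fun k h1 h2 z hz => le_trans (hM (mem_range_self k)) (hm k h1 h2 z hz)⟩
  obtain ⟨w, hw⟩ := c.ne k
  have hw : w ∈ c.U k := hw
  obtain ⟨M1, hM1⟩ := hbd (-1) (Or.inr rfl)
  obtain ⟨M2, hM2⟩ := hbd 1 (Or.inl rfl)
  obtain ⟨z, z1, z2, z3⟩ := far_right hu hab ha (M := -M1)
    (fun k h1 h2 z hz => by have := hM1 k h1 h2 z hz; linarith) (cr u w + 1)
  have hneg : ∀ p, cr (-u) p = - cr u p := by intro p; simp [cr]; ring
  obtain ⟨z', z1', z2', z3'⟩ := far_right (u := -u) (neg_ne_zero.mpr hu) (Ne.symm hab)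
    (fun φ hφ => by rw [ln_neg]; have := hb φ hφ; linarith) (M := -M2)
    (fun k h1 h2 z hz => by have := hM2 k h2 h1 z hz; rw [hneg]; linarith) (-cr u w + 1)
  rw [hneg] at z3'
  have hD : 0 < cr u z - cr u z' := by linarith
  set s := (cr u w - cr u z') / (cr u z - cr u z') with hs
  have hs0 : 0 ≤ s := div_nonneg (by linarith) hD.le
  have hs1 : s ≤ 1 := by rw [hs, div_le_one hD]; linarith
  have hsD : s * (cr u z - cr u z') = cr u w - cr u z' := by rw [hs]; field_simp
  set q := z' + s • (z - z') with hq
  have qa : q ∈ c.CU a := CU_seg z2' z1 hs0 hs1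
  have qb : q ∈ c.CU b := CU_seg z1' z2 hs0 hs1
  have hqX : cr u (w - q) = 0 := by
    rw [cr_sub, hq, cr_add, cr_smul, cr_sub]; linarith
  obtain ⟨t, ht⟩ := par_u hu (cr_self u) hqX hu
  have hwq : w = q + t • u := by rw [← ht]; abel
  rcases le_total t 0 with h | h
  · refine CU_U_disj (Ne.symm hka) (w := w) ?_ hw
    intro φ hφ
    rw [hwq, ev_add, ln_smul]
    have := qa φ hφ
    have := ha φ hφ
    nlinarith
  · refine CU_U_disj (Ne.symm hkb) (w := w) ?_ hw
    intro φ hφ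
    rw [hwq, ev_add, ln_smul]
    have := qb φ hφ
    have := hb φ hφ
    nlinarith

lemma holes_card (c : Cfg ι) (h3 : 3 ≤ Fintype.card ι) :
    {H | c.IsHole H}.Finite ∧ {H | c.IsHole H}.ncard ≤ 2 * Fintype.card ι - 5 := by
  classical
  have hne : Nonempty ι := Fintype.card_pos_iff.mp (by omega)
  obtain ⟨u, hu0, hu⟩ := exists_gen c
  obtain ⟨b, hb⟩ := exists_up hu
  obtain ⟨a, ha⟩ := exists_up hu.neg
  have ha : ∀ φ ∈ c.cons a, 0 < ln φ u := by
    intro φ hφ; have := ha φ hφ; rw [ln_neg] at this; linarith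
  have hthird : ∀ x y : ι, ∃ k, k ≠ x ∧ k ≠ y := by
    intro x y
    by_contra hcon
    push Not at hcon
    have : (Finset.univ : Finset ι) ⊆ {x, y} := by
      intro k _
      by_cases h : k = x
      · simp [h]
      · simp [hcon k h]
    have := Finset.card_le_card this
    have h2 := Finset.card_le_two (a := x) (b := y)
    rw [Finset.card_univ] at this
    omega
  have hab : a ≠ b := by
    intro h
    subst h
    have he : c.cons a = ∅ := by
      rw [Finset.eq_empty_iff_forall_notMem]
      intro φ hφ
      have := ha φ hφ; have := hb φ hφ; linarith
    obtain ⟨k, hk, _⟩ := hthird a a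
    obtain ⟨z, hz⟩ := c.ne k
    exact c.disj a k (Ne.symm hk) z (by simp [he]) hz
  obtain ⟨k0, hk0a, hk0b⟩ := hthird a b
  obtain ⟨k, hka, hkb, τ, hτ, hno⟩ := fifth hu0 hab ha hb hk0a hk0b
  let sg : Bool → ℝ := fun t => if t then 1 else -1
  have hsg : ∀ τ : ℝ, (τ = 1 ∨ τ = -1) → ∃ t, sg t = τ := by
    rintro τ (rfl | rfl)
    · exact ⟨true, by simp [sg]⟩
    · exact ⟨false, by simp [sg]⟩
  obtain ⟨t0, ht0⟩ := hsg τ hτ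
  let B : Finset (ι × Bool) := {(a, true), (a, false), (b, true), (b, false), (k, t0)}
  have hB : B.card = 5 := by
    simp only [B]
    rw [Finset.card_insert_of_notMem, Finset.card_insert_of_notMem, Finset.card_insert_of_notMem,
      Finset.card_insert_of_notMem, Finset.card_singleton]
    all_goals simp [hab, hka, hkb, Ne.symm hka, Ne.symm hkb]
  have hlab : ∀ H, ∃ x : ι × Bool, c.IsHole H → c.Lab u H x.1 (sg x.2) := by
    intro H
    by_cases h : c.IsHole H
    · obtain ⟨k, τ, hτ, hl⟩ := exists_lab hu h
      obtain ⟨t, rfl⟩ := hsg τ hτ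
      exact ⟨(k, t), fun _ => hl⟩
    · exact ⟨(a, true), fun h' => absurd h' h⟩
  choose f hf using hlab
  have hmaps : ∀ H ∈ {H | c.IsHole H}, f H ∈ ((Finset.univ \ B : Finset (ι × Bool)) : Set (ι × Bool)) := by
    intro H hH
    have hl := hf H hH
    obtain ⟨v, w, hE, _⟩ := hl
    simp only [Finset.coe_sdiff, Finset.coe_univ, Set.mem_sdiff, Set.mem_univ, true_and, Finset.mem_coe]
    intro hmem
    simp only [B, Finset.mem_insert, Finset.mem_singleton] at hmem
    rcases hmem with h | h | h | h | h <;> rw [h] at hE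
    · exact no_extr_down hu0 ha hE
    · exact no_extr_down hu0 ha hE
    · exact no_extr_up hu0 hb hE
    · exact no_extr_up hu0 hb hE
    · rw [ht0] at hE
      exact hno _ hE
  have hinj : Set.InjOn f {H | c.IsHole H} := by
    intro H hH H' hH' he
    have h1 := hf H hH
    have h2 := hf H' hH'
    rw [← he] at h2
    exact lab_inj hu0 hH hH' h1 h2
  refine ⟨Set.Finite.of_injOn hmaps hinj (Finset.finite_toSet _), ?_⟩
  have := Set.ncard_le_ncard_of_injOn f hmaps hinj (Finset.finite_toSet _)
  rw [Set.ncard_coe_finset, Finset.card_sdiff_of_subset (Finset.subset_univ _), hB, Finset.card_univ,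
    Fintype.card_prod, Fintype.card_bool] at this
  omega

end Cake

namespace Cake

open Set Filter Topology

lemma sep_unit {s t : Set (ℝ × ℝ)} (hs : Convex ℝ s) (hs' : IsOpen s) (ht : Convex ℝ t)
    (ht' : IsOpen t) (hd : Disjoint s t) (hsn : s.Nonempty) (htn : t.Nonempty) :
    ∃ ψ : Fn, ψ.a ^ 2 + ψ.b ^ 2 = 1 ∧ (∀ z ∈ s, ev ψ z < 0) ∧ ∀ z ∈ t, 0 < ev ψ z := by
  obtain ⟨ψ, h1, h2⟩ := sep_open hs hs' ht ht' hd
  have hpos : 0 < ψ.a ^ 2 + ψ.b ^ 2 := by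
    by_contra hcon
    have ha : ψ.a = 0 := by nlinarith [sq_nonneg ψ.a, sq_nonneg ψ.b]
    have hb : ψ.b = 0 := by nlinarith [sq_nonneg ψ.a, sq_nonneg ψ.b]
    obtain ⟨x, hx⟩ := hsn
    obtain ⟨y, hy⟩ := htn
    have a1 := h1 x hx
    have a2 := h2 y hy
    simp only [ev, ha, hb] at a1 a2
    linarith
  set r := Real.sqrt (ψ.a ^ 2 + ψ.b ^ 2) with hr
  have hr0 : 0 < r := Real.sqrt_pos.mpr hpos
  have hr2 : r ^ 2 = ψ.a ^ 2 + ψ.b ^ 2 := Real.sq_sqrt hpos.le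
  have hev : ∀ z, ev ⟨ψ.a / r, ψ.b / r, ψ.c / r⟩ z = ev ψ z / r := by
    intro z; simp only [ev]; field_simp
  refine ⟨⟨ψ.a / r, ψ.b / r, ψ.c / r⟩, ?_, ?_, ?_⟩
  · simp only; field_simp; rw [hr2]
  · intro z hz; rw [hev]; exact div_neg_of_neg_of_pos (h1 z hz) hr0
  · intro z hz; rw [hev]; exact div_pos (h2 z hz) hr0

def nfn (φ : Fn) : Fn := ⟨-φ.a, -φ.b, -φ.c⟩
lemma ev_nfn (φ : Fn) (p : ℝ × ℝ) : ev (nfn φ) p = - ev φ p := by simp only [ev, nfn]; ring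

/-- admissible families -/
def Good {ι : Type} (W U : ι → Set (ℝ × ℝ)) : Prop :=
  (∀ i, W i ⊆ U i ∧ IsOpen (U i) ∧ Convex ℝ (U i)) ∧ ∀ i j, i ≠ j → Disjoint (U i) (U j)

lemma exists_max {ι : Type} (W : ι → Set (ℝ × ℝ)) (hW : Good W W) :
    ∃ U, Good W U ∧ ∀ V, Good W V → (∀ i, U i ⊆ V i) → ∀ i, V i ⊆ U i := by
  obtain ⟨U, _, hU⟩ := zorn_le_nonempty₀ {U | Good W U} (by
    intro ch hch hchain y hy
    refine ⟨fun i => ⋃ U ∈ ch, U i, ⟨?_, ?_⟩, ?_⟩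
    · intro i
      refine ⟨?_, ?_, ?_⟩
      · intro p hp
        exact mem_biUnion hy (((hch hy).1 i).1 hp)
      · exact isOpen_biUnion fun U hU => ((hch hU).1 i).2.1
      · intro p hp q hq α β hα hβ hab
        obtain ⟨U1, h1, hp⟩ := mem_iUnion₂.mp hp
        obtain ⟨U2, h2, hq⟩ := mem_iUnion₂.mp hq
        rcases hchain.total h1 h2 with h | h
        · exact mem_biUnion h2 (((hch h2).1 i).2.2 (h i hp) hq hα hβ hab)
        · exact mem_biUnion h1 (((hch h1).1 i).2.2 hp (h i hq) hα hβ hab)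
    · intro i j hij
      rw [Set.disjoint_left]
      intro p hp hq
      obtain ⟨U1, h1, hp⟩ := mem_iUnion₂.mp hp
      obtain ⟨U2, h2, hq⟩ := mem_iUnion₂.mp hq
      rcases hchain.total h1 h2 with h | h
      · exact Set.disjoint_left.mp ((hch h2).2 i j hij) (h i hp) hq
      · exact Set.disjoint_left.mp ((hch h1).2 i j hij) hp (h j hq)
    · intro z hz i p hp
      exact mem_biUnion hz hp) W hW
  refine ⟨U, hU.1, fun V hV hUV i => ?_⟩
  exact hU.2 hV (fun i => hUV i) i

lemma exists_cfg {ι : Type} [Fintype ι] (W : ι → Set (ℝ × ℝ)) (hW : Good W W)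
    (hne : ∀ i, (W i).Nonempty) : ∃ c : Cfg ι, ∀ i, W i ⊆ c.U i := by
  classical
  obtain ⟨U, hU, hmax⟩ := exists_max W hW
  have hUne : ∀ i, (U i).Nonempty := fun i => (hne i).mono (hU.1 i).1
  have : ∀ i j, ∃ ψ : Fn, i ≠ j → ψ.a ^ 2 + ψ.b ^ 2 = 1 ∧ (∀ z ∈ U i, ev ψ z < 0) ∧
      ∀ z ∈ U j, 0 < ev ψ z := by
    intro i j
    by_cases h : i = j
    · exact ⟨⟨0, 0, 0⟩, fun h' => absurd h h'⟩
    · obtain ⟨ψ, hψ⟩ := sep_unit (hU.1 i).2.2 (hU.1 i).2.1 (hU.1 j).2.2 (hU.1 j).2.1 (hU.2 i j h)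
        (hUne i) (hUne j)
      exact ⟨ψ, fun _ => hψ⟩
  choose ψ hψ using this
  let cons : ι → Finset Fn := fun i =>
    ((Finset.univ.filter fun j => j ≠ i).image fun j => ψ i j) ∪
      ((Finset.univ.filter fun j => j ≠ i).image fun j => nfn (ψ j i))
  have hcons : ∀ i φ, φ ∈ cons i ↔ ∃ j, j ≠ i ∧ (φ = ψ i j ∨ φ = nfn (ψ j i)) := by
    intro i φ
    simp only [cons, Finset.mem_union, Finset.mem_image, Finset.mem_filter, Finset.mem_univ, true_and]
    constructor
    · rintro (⟨j, hj, rfl⟩ | ⟨j, hj, rfl⟩)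
      · exact ⟨j, hj, Or.inl rfl⟩
      · exact ⟨j, hj, Or.inr rfl⟩
    · rintro ⟨j, hj, rfl | rfl⟩
      · exact Or.inl ⟨j, hj, rfl⟩
      · exact Or.inr ⟨j, hj, rfl⟩
  let V : ι → Set (ℝ × ℝ) := fun i => ⋂ φ ∈ cons i, {p | ev φ p < 0}
  have hVmem : ∀ i p, p ∈ V i ↔ ∀ φ ∈ cons i, ev φ p < 0 := by
    intro i p; simp [V]
  have hUV : ∀ i, U i ⊆ V i := by
    intro i p hp
    rw [hVmem]
    intro φ hφ
    obtain ⟨j, hj, rfl | rfl⟩ := (hcons i φ).mp hφ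
    · exact (hψ i j (Ne.symm hj)).2.1 p hp
    · rw [ev_nfn]
      have := (hψ j i hj).2.2 p hp
      linarith
  have hVdisj : ∀ i j, i ≠ j → ∀ p, p ∈ V i → p ∈ V j → False := by
    intro i j hij p h1 h2
    rw [hVmem] at h1 h2
    have a1 := h1 (ψ i j) ((hcons _ _).mpr ⟨j, Ne.symm hij, Or.inl rfl⟩)
    have a2 := h2 (nfn (ψ i j)) ((hcons _ _).mpr ⟨i, hij, Or.inr rfl⟩)
    rw [ev_nfn] at a2
    linarith
  have hVgood : Good W V := by
    refine ⟨fun i => ⟨(hU.1 i).1.trans (hUV i), ?_, ?_⟩, fun i j hij => ?_⟩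
    · exact isOpen_biInter_finset fun φ _ => isOpen_lt (ev_continuous φ) continuous_const
    · exact convex_iInter₂ fun φ _ => convex_ev_lt φ
    · rw [Set.disjoint_left]; exact fun p h1 h2 => hVdisj i j hij p h1 h2
  have hVU : ∀ i, V i = U i := fun i => Subset.antisymm (hmax V hVgood hUV i) (hUV i)
  have hUmem : ∀ i p, p ∈ U i ↔ ∀ φ ∈ cons i, ev φ p < 0 := by
    intro i p; rw [← hVU, hVmem]
  refine ⟨⟨cons, ?_, ?_, ?_, ?_⟩, ?_⟩
  · intro i φ hφ
    obtain ⟨j, hj, rfl | rfl⟩ := (hcons i φ).mp hφ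
    · exact (hψ i j (Ne.symm hj)).1
    · have := (hψ j i hj).1
      simp only [nfn]; linarith
  · intro i
    obtain ⟨p, hp⟩ := hUne i
    exact ⟨p, (hUmem i p).mp hp⟩
  · intro i j hij p h1 h2
    exact hVdisj i j hij p ((hVmem i p).mpr h1) ((hVmem j p).mpr h2)
  · intro i V' hop hcv hsub hdis p hp
    rw [← hUmem]
    have hg : Good W (Function.update U i V') := by
      refine ⟨fun j => ?_, fun j k hjk => ?_⟩
      · by_cases h : j = i
        · subst h
          rw [Function.update_self]
          exact ⟨fun q hq => hsub q ((hUmem j q).mp ((hU.1 j).1 hq)), hop, hcv⟩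
        · rw [Function.update_of_ne h]
          exact hU.1 j
      · by_cases h : j = i
        · subst h
          rw [Function.update_self, Function.update_of_ne (Ne.symm hjk), Set.disjoint_left]
          intro q h1 h2
          exact hdis k (Ne.symm hjk) q h1 ((hUmem k q).mp h2)
        · by_cases h' : k = i
          · subst h'
            rw [Function.update_self, Function.update_of_ne h, Set.disjoint_right]
            intro q h1 h2
            exact hdis j h q h1 ((hUmem j q).mp h2)
          · rw [Function.update_of_ne h, Function.update_of_ne h']
            exact hU.2 j k hjk
    have := hmax _ hg (fun j => by
      by_cases h : j = i
      · subst h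
        rw [Function.update_self]
        exact fun q hq => hsub q ((hUmem j q).mp hq)
      · rw [Function.update_of_ne h]) i
    rw [Function.update_self] at this
    exact this hp
  · intro i p hp
    exact (hUmem i p).mp ((hU.1 i).1 hp)

lemma CU_closure {ι : Type} [Fintype ι] {c : Cfg ι} (i : ι) : c.CU i ⊆ closure (c.U i) := by
  intro p hp
  obtain ⟨z, hz⟩ := c.ne i
  refine mem_closure_of_enter (w := z - p) ?_
  filter_upwards [ev01, self_mem_nhdsWithin] with ε h1 h2
  exact mem_U_of_CU c hp hz h2 h1


theorem main_partition (C : Set (ℝ × ℝ)) (hC : IsConvexBody C)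
    (m : ℕ) (hm : 3 ≤ m) (Z : Fin m → Set (ℝ × ℝ))
    (hZbody : ∀ i, IsConvexBody (Z i))
    (hZsub : ∀ i, Z i ⊆ C)
    (hZdisj : ∀ i j, i ≠ j → Disjoint (Z i) (Z j)) :
    ∃ b : ℕ, b ≤ 2 * m - 5 ∧
      ∃ Z' : Fin (m + b) → Set (ℝ × ℝ),
        (∀ i, IsConvexBody (Z' i)) ∧
        (∀ i j, i ≠ j → Disjoint (interior (Z' i)) (interior (Z' j))) ∧
        (⋃ i, Z' i) = C ∧
        (∀ i : Fin m, Z i ⊆ Z' (Fin.castAdd b i)) := by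
  obtain ⟨c, hc⟩ := exists_cfg (fun i => interior (Z i))
    ⟨fun i => ⟨Subset.rfl, isOpen_interior, (hZbody i).2.1.interior⟩, fun i j hij =>
      (hZdisj i j hij).mono interior_subset interior_subset⟩ (fun i => (hZbody i).2.2)
  have hcl : ∀ S, IsConvexBody S → S ⊆ closure (interior S) := by
    intro S hS
    rw [hS.2.1.closure_interior_eq_closure_of_nonempty_interior hS.2.2]
    exact subset_closure
  have hZCU : ∀ i, Z i ⊆ c.CU i := fun i =>
    (hcl _ (hZbody i)).trans (closure_minimal ((hc i).trans (U_sub_CU c i)) (closed_CU c i))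
  obtain ⟨hfin, hcard⟩ := holes_card c (by simpa using hm)
  rw [Fintype.card_fin] at hcard
  let T : Set (Set (ℝ × ℝ)) := {H | c.IsHole H ∧ (H ∩ interior C).Nonempty}
  have hTs : T ⊆ {H | c.IsHole H} := fun H h => h.1
  have hTfin : T.Finite := hfin.subset hTs
  have hTcard : T.ncard ≤ 2 * m - 5 := (Set.ncard_le_ncard hTs hfin).trans hcard
  have : Finite T := hTfin.to_subtype
  obtain ⟨b, hb, ⟨g⟩⟩ : ∃ b, b ≤ 2 * m - 5 ∧ Nonempty (Fin b ≃ T) :=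
    ⟨T.ncard, hTcard, ⟨(Finite.equivFinOfCardEq (Nat.card_coe_set_eq T)).symm⟩⟩
  let O : Fin (m + b) → Set (ℝ × ℝ) := Fin.addCases (fun i => c.U i) (fun j => (g j).1)
  let D : Fin (m + b) → Set (ℝ × ℝ) := Fin.addCases (fun i => c.CU i) (fun j => closure (g j).1)
  have OL : ∀ i, O (Fin.castAdd b i) = c.U i := fun i => Fin.addCases_left i
  have OR : ∀ j, O (Fin.natAdd m j) = (g j).1 := fun j => Fin.addCases_right j
  have DL : ∀ i, D (Fin.castAdd b i) = c.CU i := fun i => Fin.addCases_left i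
  have DR : ∀ j, D (Fin.natAdd m j) = closure (g j).1 := fun j => Fin.addCases_right j
  have hO : ∀ x, IsOpen (O x) ∧ (O x ∩ interior C).Nonempty ∧ O x ⊆ D x ∧ D x ⊆ closure (O x) ∧
      IsClosed (D x) ∧ Convex ℝ (D x) := by
    refine Fin.addCases (fun i => ?_) (fun j => ?_)
    · rw [OL, DL]
      refine ⟨open_U c i, ?_, U_sub_CU c i, CU_closure i, closed_CU c i, convex_CU c i⟩
      obtain ⟨p, hp⟩ := (hZbody i).2.2
      exact ⟨p, hc i hp, interior_mono (hZsub i) hp⟩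
    · rw [OR, DR]
      exact ⟨(g j).2.1.isOpen, (g j).2.2, subset_closure, Subset.rfl, isClosed_closure,
        (g j).2.1.convex.closure⟩
  have hOd : ∀ x y, x ≠ y → Disjoint (O x) (O y) := by
    have hUH : ∀ i j, Disjoint (c.U i) (g j).1 := by
      intro i j
      rw [Set.disjoint_left]
      exact fun p h1 h2 => (g j).2.1.sub h2 i (U_sub_CU c i h1)
    refine Fin.addCases (fun i => ?_) (fun j => ?_) <;>
      refine Fin.addCases (fun i' => ?_) (fun j' => ?_) <;> intro hne
    · rw [OL, OL, Set.disjoint_left]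
      exact fun p h1 h2 => disjU (fun h => hne (by rw [h])) h1 h2
    · rw [OL, OR]; exact hUH i j'
    · rw [OL, OR]; exact (hUH i' j).symm
    · rw [OR, OR, Set.disjoint_left]
      intro p h1 h2
      apply hne
      have := hole_eq (g j).2.1 (g j').2.1 h1 h2
      rw [g.injective (Subtype.ext this)]
  refine ⟨b, hb, fun x => D x ∩ C, ?_, ?_, ?_, ?_⟩
  · intro x
    obtain ⟨h1, ⟨p, hp⟩, h3, h4, h5, h6⟩ := hO x
    refine ⟨hC.1.inter_left h5, h6.inter hC.2.1, ⟨p, ?_⟩⟩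
    exact interior_maximal (inter_subset_inter h3 interior_subset) (h1.inter isOpen_interior) hp
  · intro x y hxy
    have a1 : Disjoint (closure (O x)) (O y) := (hOd x y hxy).closure_left (hO y).1
    have a2 : Disjoint (interior (closure (O x))) (closure (O y)) :=
      (a1.mono_left interior_subset).closure_right isOpen_interior
    exact a2.mono (interior_mono (inter_subset_left.trans (hO x).2.2.2.1))
      (interior_subset.trans (inter_subset_left.trans (hO y).2.2.2.1))
  · apply Subset.antisymm
    · exact iUnion_subset fun x => inter_subset_right
    · have hclosed : IsClosed (⋃ x, D x ∩ C) :=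
        isClosed_iUnion_of_finite fun x => (hO x).2.2.2.2.1.inter hC.1.isClosed
      refine (hcl C hC).trans (closure_minimal ?_ hclosed)
      intro p hp
      rw [mem_iUnion]
      by_cases hK : p ∈ c.K
      · obtain ⟨H, hH, hpH⟩ := hole_of hK
        let h : T := ⟨H, hH, p, hpH, hp⟩
        refine ⟨Fin.natAdd m (g.symm h), ?_, interior_subset hp⟩
        rw [DR, Equiv.apply_symm_apply]
        exact subset_closure hpH
      · have : ∃ i, p ∈ c.CU i := by
          by_contra hcon
          push Not at hcon
          exact hK hcon
        obtain ⟨i, hi⟩ := this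
        refine ⟨Fin.castAdd b i, ?_, interior_subset hp⟩
        rw [DL]; exact hi
  · intro i p hp
    refine ⟨?_, hZsub i hp⟩
    rw [DL]
    exact hZCU i hp

end Cake

theorem convex_cake_partition (C : Set (ℝ × ℝ)) (hC : IsConvexBody C)
    (m : ℕ) (hm : 3 ≤ m) (Z : Fin m → Set (ℝ × ℝ))
    (hZbody : ∀ i, IsConvexBody (Z i))
    (hZsub : ∀ i, Z i ⊆ C)
    (hZdisj : ∀ i j, i ≠ j → Disjoint (Z i) (Z j)) :
    ∃ b : ℕ, b ≤ 2 * m - 5 ∧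
      ∃ Z' : Fin (m + b) → Set (ℝ × ℝ),
        (∀ i, IsConvexBody (Z' i)) ∧
        (∀ i j, i ≠ j → Disjoint (interior (Z' i)) (interior (Z' j))) ∧
        (⋃ i, Z' i) = C ∧
        (∀ i : Fin m, Z i ⊆ Z' (Fin.castAdd b i)) := by
  exact Cake.main_partition C hC m hm Z hZbody hZsub hZdisj
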